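/- arXiv:2004.12561 — 3 statements merged into one kernel-verified Lean document; each statement's English description precedes it below -/
import Mathlib

section
/- Let n, k, t be positive integers with n > 3k²t. Let F_1, …, F_t ⊆ C([n],k) satisfy |F_i| > C(n,k) − C(n−t+1,k) for every i ∈ [t]. Then {F_1, …, F_t} admits a rainbow matching. -/
open Finset

section Binomial

/-- Increments of `m ↦ C(m, k)` are monotone, so an increment over `s` steps below `m + 1` is
at most `s` times the last one. -/
lemma choose_add_le_of_choose_succ_eq {m k D : ℕ} (hD : (m + 1).choose k = m.choose k + D)
    (a s : ℕ) (h : a + s ≤ m + 1) : (a + s).choose k ≤ a.choose k + s * D := by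
  induction s with
  | zero => simp
  | succ s ih =>
    have ih := ih (by omega)
    have hstep : (a + s + 1).choose k ≤ (a + s).choose k + D := by
      cases k with
      | zero => simp
      | succ k =>
        rw [Nat.choose_succ_succ] at hD ⊢
        have := Nat.choose_le_choose k (show a + s ≤ m by omega)
        simp only [Nat.succ_eq_add_one] at *
        omega
    rw [← add_assoc, add_mul]
    omega

lemma choose_succ_add_mul_choose_le (a k s : ℕ) :
    a.choose (k + 1) + s * a.choose k ≤ (a + s).choose (k + 1) := by
  induction s with
  | zero => simp
  | succ s ih =>
    rw [← add_assoc, Nat.choose_succ_succ, add_mul]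
    have := Nat.choose_le_choose k (show a ≤ a + s by omega)
    simp only [Nat.succ_eq_add_one]
    omega

/-- The number `D` of `k`-subsets of an `(m + 1)`-set through a given point satisfies
`(m + 1) D = k C(m + 1, k)`. -/
lemma succ_mul_eq_of_choose_succ_eq {m k D : ℕ} (hk : k ≤ m + 1)
    (hD : (m + 1).choose k = m.choose k + D) : (m + 1) * D = k * (m + 1).choose k := by
  have h := Nat.choose_mul_succ_eq m k
  obtain ⟨r, hr⟩ := Nat.exists_eq_add_of_le hk
  have hr' : m + 1 - k = r := by omega
  rw [hr'] at h
  have h2 : m.choose k * (m + 1) + D * (m + 1) = (m + 1).choose k * (m + 1) := by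
    rw [hD]; ring
  have h3 : (m + 1).choose k * (m + 1) = (m + 1).choose k * k + (m + 1).choose k * r := by
    rw [← mul_add, ← hr]
  linarith

lemma three_mul_succ_le (k s : ℕ) : 3 * (s + 1) ≤ 3 * (k + 1) ^ 2 * (s + 1) :=
  Nat.mul_le_mul_right _ (Nat.le_mul_of_pos_right 3 (by positivity))

lemma three_mul_mul_le_choose {m k D s : ℕ} (hD : (m + 1).choose k = m.choose k + D)
    (hm : 3 * (k + 1) ^ 2 * (s + 1) < m + 2) :
    3 * (k + 1) * s * D ≤ (m + 2 - s).choose k := by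
  have hsm := three_mul_succ_le k s
  have hkm : k ≤ m + 1 := by nlinarith
  obtain rfl | hs := Nat.eq_zero_or_pos s
  · simp
  have h1 := choose_add_le_of_choose_succ_eq hD (m + 2 - s) (s - 1) (by omega)
  have h2 := succ_mul_eq_of_choose_succ_eq hkm hD
  rw [show m + 2 - s + (s - 1) = m + 1 by omega] at h1
  have h3 : (s - 1) * D ≤ s * D := Nat.mul_le_mul_right _ (by omega)
  suffices 3 * (k + 1) * s * D + s * D ≤ (m + 1).choose k by omega
  obtain rfl | hk := Nat.eq_zero_or_pos k
  · simp at hD; simp [hD]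
  have h4 : k * (3 * (k + 1) * s + s) ≤ m + 1 := by nlinarith [Nat.mul_le_mul hk hs]
  refine Nat.le_of_mul_le_mul_left ?_ hk
  calc k * (3 * (k + 1) * s * D + s * D) = k * (3 * (k + 1) * s + s) * D := by ring
    _ ≤ (m + 1) * D := Nat.mul_le_mul_right _ h4
    _ = _ := h2

end Binomial

section Families

variable {α ι : Type*} [DecidableEq α]

lemma card_filter_mem_powersetCard_add {V : Finset α} {u : α} (hu : u ∈ V) (k : ℕ) :
    #{e ∈ V.powersetCard k | u ∈ e} + (#V - 1).choose k = (#V).choose k := by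
  rw [← card_erase_of_mem hu, ← card_powersetCard, ← card_powersetCard,
    ← card_filter_add_card_filter_not (s := V.powersetCard k) (fun e => u ∈ e)]
  congr 2
  ext e
  simp only [mem_powersetCard, mem_filter, subset_erase]
  tauto

lemma card_filter_mem_le {V : Finset α} {F : Finset (Finset α)} {k : ℕ}
    (hF : F ⊆ V.powersetCard (k + 1)) {v : α} (hv : v ∈ V) :
    #{e ∈ F | v ∈ e} ≤ (#V - 1).choose k := by
  have h := card_filter_mem_powersetCard_add hv (k + 1)
  have h' := card_le_card (filter_subset_filter (fun e => v ∈ e) hF)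
  obtain ⟨m, hm⟩ := Nat.exists_eq_add_of_lt (card_pos.2 ⟨v, hv⟩)
  rw [hm, Nat.choose_succ_succ] at h
  rw [hm]
  simp only [zero_add, Nat.add_sub_cancel, Nat.succ_eq_add_one] at *
  omega

lemma card_image_erase_of_forall_mem {G : Finset (Finset α)} {v : α} (hG : ∀ e ∈ G, v ∈ e) :
    #(G.image (·.erase v)) = #G := by
  refine card_image_of_injOn fun e he f hf h => ?_
  rw [← insert_erase (hG e he), ← insert_erase (hG f hf)]
  exact congrArg _ h

lemma card_filter_mem_mem_le {V : Finset α} {F : Finset (Finset α)} {k D : ℕ}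
    (hF : F ⊆ V.powersetCard (k + 1))
    (hD : (#V - 1).choose k = (#V - 2).choose k + D) {u v : α} (hv : v ∈ V) (hu : u ∈ V)
    (huv : u ≠ v) : #{e ∈ {e ∈ F | v ∈ e} | u ∈ e} ≤ D := by
  have h := card_filter_mem_powersetCard_add (mem_erase.2 ⟨huv, hu⟩) k
  rw [card_erase_of_mem hv, hD, Nat.sub_sub, one_add_one_eq_two] at h
  rw [← card_image_erase_of_forall_mem (v := v) (by simp +contextual)]
  refine (card_le_card (t := {e ∈ (V.erase v).powersetCard k | u ∈ e}) ?_).trans (by omega)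
  intro e he
  simp only [mem_image, mem_filter] at he
  obtain ⟨f, ⟨⟨hf, hvf⟩, huf⟩, rfl⟩ := he
  have hf := mem_powersetCard.1 (hF hf)
  simp only [mem_filter, mem_powersetCard, mem_erase]
  refine ⟨⟨erase_subset_erase _ hf.1, ?_⟩, huv, huf⟩
  rw [card_erase_of_mem hvf, hf.2]; rfl

lemma card_le_card_filter_disjoint_add_sum (G : Finset (Finset α)) (U : Finset α) :
    #G ≤ #{e ∈ G | Disjoint e U} + ∑ u ∈ U, #{e ∈ G | u ∈ e} := by
  rw [← card_filter_add_card_filter_not (s := G) (fun e => Disjoint e U)]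
  refine Nat.add_le_add_left ((card_le_card ?_).trans card_biUnion_le) _
  intro e he
  simp only [mem_filter, not_disjoint_iff] at he
  obtain ⟨he, u, hue, hu⟩ := he
  exact mem_biUnion.2 ⟨u, hu, mem_filter.2 ⟨he, hue⟩⟩

lemma exists_disjoint_of_sum_lt {G : Finset (Finset α)} {U : Finset α}
    (h : ∑ u ∈ U, #{e ∈ G | u ∈ e} < #G) : ∃ e ∈ G, Disjoint e U := by
  have := card_le_card_filter_disjoint_add_sum G U
  obtain ⟨e, he⟩ := card_pos.1 (show 0 < #{e ∈ G | Disjoint e U} by omega)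
  exact ⟨e, mem_filter.1 he⟩

/-- `F` restricted to the indices in `I` admits a rainbow matching. -/
def HasRainbowMatching (I : Finset ι) (F : ι → Finset (Finset α)) : Prop :=
  ∃ e : ι → Finset α, (∀ i ∈ I, e i ∈ F i) ∧ (I : Set ι).PairwiseDisjoint e

lemma HasRainbowMatching.of_erase [DecidableEq ι] {I : Finset ι} {F : ι → Finset (Finset α)}
    {i : ι} {e : ι → Finset α} (he : ∀ j ∈ I.erase i, e j ∈ F j)
    (hd : (I.erase i : Set ι).PairwiseDisjoint e) {f : Finset α} (hf : f ∈ F i)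
    (hfd : Disjoint f ((I.erase i).biUnion e)) : HasRainbowMatching I F := by
  rw [disjoint_biUnion_right] at hfd
  refine ⟨Function.update e i f, fun j hj => ?_, fun a ha b hb hab => ?_⟩
  · by_cases hji : j = i
    · subst hji; simpa
    · simpa [hji] using he j (by simp [hji, hj])
  · simp only [Function.onFun]
    by_cases hai : a = i
    · subst hai
      simpa [hab.symm] using hfd b (mem_erase.2 ⟨hab.symm, hb⟩)
    · by_cases hbi : b = i
      · subst hbi
        simpa [hab] using (hfd a (mem_erase.2 ⟨hab, ha⟩)).symm
      · simpa [hai, hbi] using hd (by simp [hai, mem_coe.1 ha]) (by simp [hbi, mem_coe.1 hb]) hab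

lemma exists_injOn_of_card_le [DecidableEq ι] [Nonempty α] (I : Finset ι) (H : ι → Finset α)
    (h : ∀ i ∈ I, #I ≤ #(H i)) : ∃ v : ι → α, (∀ i ∈ I, v i ∈ H i) ∧ Set.InjOn v I := by
  induction I using Finset.induction_on with
  | empty => exact ⟨fun _ => Classical.arbitrary α, by simp, by simp⟩
  | insert a s ha ih =>
    rw [card_insert_of_notMem ha] at h
    obtain ⟨v, hv, hinj⟩ := ih fun i hi => (Nat.le_succ _).trans (h i (mem_insert_of_mem hi))
    obtain ⟨x, hx, hxs⟩ := exists_mem_notMem_of_card_lt_card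
      ((card_image_le (s := s) (f := v)).trans_lt (h a (mem_insert_self a s)))
    have hne : ∀ i ∈ s, i ≠ a := fun i hi h => ha (h ▸ hi)
    have heq : Set.EqOn v (Function.update v a x) s := fun i hi => by simp [hne i hi]
    refine ⟨Function.update v a x, fun i hi => ?_, ?_⟩
    · obtain rfl | hi := mem_insert.1 hi
      · simpa
      · simpa [hne i hi] using hv i hi
    · rw [coe_insert, Set.injOn_insert (by simpa)]
      refine ⟨hinj.congr heq, ?_⟩
      rw [← heq.image_eq]
      simpa using hxs

lemma card_biUnion_le_of_mem {V : Finset α} {I : Finset ι} {F : ι → Finset (Finset α)} {k : ℕ}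
    (hF : ∀ i ∈ I, F i ⊆ V.powersetCard k) {e : ι → Finset α} (he : ∀ i ∈ I, e i ∈ F i) :
    I.biUnion e ⊆ V ∧ #(I.biUnion e) ≤ k * #I := by
  have h i (hi : i ∈ I) := mem_powersetCard.1 (hF i hi (he i hi))
  refine ⟨biUnion_subset.2 fun i hi => (h i hi).1, ?_⟩
  rw [mul_comm]
  exact card_biUnion_le_card_mul _ _ _ fun i hi => (h i hi).2.le

/-- A vertex of large degree in one family extends a matching of the others avoiding it. -/
lemma HasRainbowMatching.of_large_degree [DecidableEq ι] {V : Finset α} {I : Finset ι}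
    {F : ι → Finset (Finset α)} {k D : ℕ} (hF : ∀ i ∈ I, F i ⊆ V.powersetCard (k + 1))
    (hD : (#V - 1).choose k = (#V - 2).choose k + D) {i : ι} (hi : i ∈ I) {v : α} (hv : v ∈ V)
    (hdeg : (k + 1) * (#I - 1) * D < #{e ∈ F i | v ∈ e})
    (h : HasRainbowMatching (I.erase i) fun j => {e ∈ F j | v ∉ e}) :
    HasRainbowMatching I F := by
  obtain ⟨e, he, hd⟩ := h
  have heF j (hj : j ∈ I.erase i) : e j ∈ F j := (mem_filter.1 (he j hj)).1
  obtain ⟨hUV, hU⟩ := card_biUnion_le_of_mem (fun j hj => hF j (mem_of_mem_erase hj)) heF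
  rw [card_erase_of_mem hi] at hU
  obtain ⟨f, hf, hfd⟩ : ∃ f ∈ {e ∈ F i | v ∈ e}, Disjoint f ((I.erase i).biUnion e) := by
    refine exists_disjoint_of_sum_lt (lt_of_le_of_lt ?_ hdeg)
    refine (sum_le_card_nsmul _ _ D fun u hu => ?_).trans (Nat.mul_le_mul_right _ hU)
    refine card_filter_mem_mem_le (hF i hi) hD hv (hUV hu) ?_
    rintro rfl
    obtain ⟨j, hj, huj⟩ := mem_biUnion.1 hu
    exact (mem_filter.1 (he j hj)).2 huj
  exact .of_erase heF hd (mem_filter.1 hf).1 hfd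

/-- If few vertices have degree above a threshold in one family and no degree is large, then a
matching of the other families extends. -/
lemma HasRainbowMatching.of_few_heavy [DecidableEq ι] {V : Finset α} {I : Finset ι}
    {F : ι → Finset (Finset α)} {k D : ℕ} (hF : ∀ i ∈ I, F i ⊆ V.powersetCard (k + 1))
    {i : ι} (hi : i ∈ I)
    (hdeg : ∀ v ∈ V, #{e ∈ F i | v ∈ e} ≤ (k + 1) * (#I - 1) * D)
    (hheavy : #{v ∈ V | 2 * (#I - 1) * D < #{e ∈ F i | v ∈ e}} ≤ #I - 1)
    (hcard : 3 * (k + 1) * (#I - 1) * D * (#I - 1) < #(F i))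
    (h : HasRainbowMatching (I.erase i) F) : HasRainbowMatching I F := by
  obtain ⟨e, he, hd⟩ := h
  obtain ⟨hUV, hU⟩ := card_biUnion_le_of_mem (fun j hj => hF j (mem_of_mem_erase hj)) he
  rw [card_erase_of_mem hi] at hU
  set U := (I.erase i).biUnion e
  set s := #I - 1
  obtain ⟨f, hf, hfd⟩ : ∃ f ∈ F i, Disjoint f U := by
    refine exists_disjoint_of_sum_lt (lt_of_le_of_lt ?_ hcard)
    rw [← sum_filter_add_sum_filter_not U (fun v => 2 * s * D < #{e ∈ F i | v ∈ e})]
    have h1 : ∑ u ∈ U with 2 * s * D < #{e ∈ F i | u ∈ e}, #{e ∈ F i | u ∈ e}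
        ≤ s * ((k + 1) * s * D) :=
      (sum_le_card_nsmul _ _ _ fun u hu => hdeg u (hUV (mem_filter.1 hu).1)).trans
        (Nat.mul_le_mul_right _
          ((card_le_card (filter_subset_filter _ hUV)).trans hheavy))
    have h2 : ∑ u ∈ U with ¬ 2 * s * D < #{e ∈ F i | u ∈ e}, #{e ∈ F i | u ∈ e}
        ≤ (k + 1) * s * (2 * s * D) :=
      (sum_le_card_nsmul _ _ _ fun u hu => not_lt.1 (mem_filter.1 hu).2).trans
        (Nat.mul_le_mul_right _ ((card_filter_le _ _).trans hU))
    calc _ ≤ _ := Nat.add_le_add h1 h2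
      _ = _ := by ring
  exact .of_erase he hd hf hfd

/-- The edges of `F` meeting `S` exactly in `v`, with `v` removed. -/
def exactLink (F : Finset (Finset α)) (S : Finset α) (v : α) : Finset (Finset α) :=
  {e ∈ {e ∈ F | v ∈ e} | Disjoint e (S.erase v)}.image (·.erase v)

lemma mem_exactLink {F : Finset (Finset α)} {S : Finset α} {v : α} {e : Finset α} :
    e ∈ exactLink F S v ↔ v ∉ e ∧ insert v e ∈ F ∧ Disjoint (insert v e) (S.erase v) := by
  simp only [exactLink, mem_image, mem_filter]
  constructor
  · rintro ⟨f, ⟨⟨hf, hvf⟩, hd⟩, rfl⟩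
    rw [insert_erase hvf]
    exact ⟨notMem_erase _ _, hf, hd⟩
  · rintro ⟨hv, he, hd⟩
    exact ⟨insert v e, ⟨⟨he, mem_insert_self _ _⟩, hd⟩, erase_insert hv⟩

lemma exactLink_subset {V S : Finset α} {F : Finset (Finset α)} {k : ℕ}
    (hF : F ⊆ V.powersetCard (k + 1)) (v : α) :
    exactLink F S v ⊆ (V \ S).powersetCard k := by
  intro e he
  obtain ⟨hv, he, hd⟩ := mem_exactLink.1 he
  obtain ⟨heV, hc⟩ := mem_powersetCard.1 (hF he)
  rw [card_insert_of_notMem hv] at hc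
  refine mem_powersetCard.2 ⟨fun x hx => mem_sdiff.2 ⟨heV (mem_insert_of_mem hx), fun hxS => ?_⟩,
    by omega⟩
  exact disjoint_left.1 hd (mem_insert_of_mem hx)
    (mem_erase.2 ⟨fun h => hv (h ▸ hx), hxS⟩)

lemma card_filter_mem_le_card_exactLink_add {V S : Finset α} {F : Finset (Finset α)} {k D : ℕ}
    (hF : F ⊆ V.powersetCard (k + 1)) (hD : (#V - 1).choose k = (#V - 2).choose k + D)
    (hS : S ⊆ V) {v : α} (hv : v ∈ S) :
    #{e ∈ F | v ∈ e} ≤ #(exactLink F S v) + (#S - 1) * D := by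
  rw [exactLink, card_image_erase_of_forall_mem (by simp +contextual)]
  refine (card_le_card_filter_disjoint_add_sum _ (S.erase v)).trans (Nat.add_le_add_left ?_ _)
  rw [← card_erase_of_mem hv]
  refine sum_le_card_nsmul _ _ D fun u hu => ?_
  exact card_filter_mem_mem_le hF hD (hS hv) (hS (mem_of_mem_erase hu)) (ne_of_mem_erase hu)

lemma HasRainbowMatching.of_exactLink {I : Finset ι} {F : ι → Finset (Finset α)} {v : ι → α}
    (hv : Set.InjOn v I)
    (h : HasRainbowMatching I fun i => exactLink (F i) (I.image v) (v i)) :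
    HasRainbowMatching I F := by
  obtain ⟨e, he, hd⟩ := h
  have he i (hi : i ∈ I) := mem_exactLink.1 (he i hi)
  have hnot {a b : ι} (ha : a ∈ I) (hb : b ∈ I) (hab : a ≠ b) : v a ∉ insert (v b) (e b) :=
    fun hm => disjoint_left.1 (he b hb).2.2 hm
      (mem_erase.2 ⟨fun h => hab (hv ha hb h), mem_image_of_mem v ha⟩)
  refine ⟨fun i => insert (v i) (e i), fun i hi => (he i hi).2.1, fun a ha b hb hab => ?_⟩
  rw [Function.onFun, disjoint_insert_left]
  refine ⟨hnot ha hb hab, ?_⟩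
  rw [disjoint_insert_right]
  exact ⟨fun hm => hnot hb ha hab.symm (mem_insert_of_mem hm), hd ha hb hab⟩

/-- The Huang–Loh–Sudakov theorem, for families indexed by a finset on a finset of vertices. -/
theorem hasRainbowMatching_of_choose_lt [DecidableEq ι] (k : ℕ) (I : Finset ι) (V : Finset α)
    (F : ι → Finset (Finset α)) (hV : 3 * k ^ 2 * #I < #V)
    (hF : ∀ i ∈ I, F i ⊆ V.powersetCard k)
    (hcard : ∀ i ∈ I, (#V).choose k < #(F i) + (#V + 1 - #I).choose k) :
    HasRainbowMatching I F := by
  induction k generalizing I V F with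
  | zero =>
    refine ⟨fun _ => ∅, fun i hi => ?_, fun _ _ _ _ _ => disjoint_empty_left _⟩
    obtain ⟨e, he⟩ := card_pos.1 (show 0 < #(F i) by simpa using hcard i hi)
    have := hF i hi he
    simp only [powersetCard_zero, mem_singleton] at this
    exact this ▸ he
  | succ k ihk =>
    induction hs : #I generalizing I V F with
    | zero =>
      rw [card_eq_zero] at hs
      subst hs
      exact ⟨fun _ => ∅, by simp, by simp⟩
    | succ s ihs =>
      replace hV : 3 * (k + 1) ^ 2 * (s + 1) < #V := by simpa [hs] using hV
      rw [hs] at hcard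
      have hsm := three_mul_succ_le k s
      obtain ⟨m, hm⟩ : ∃ m, #V = m + 2 := ⟨#V - 2, by omega⟩
      rw [hm] at hV
      obtain ⟨D, hD⟩ := Nat.exists_eq_add_of_le (Nat.choose_le_choose k (Nat.le_succ m))
      simp only [Nat.succ_eq_add_one] at hD
      have hDV : (#V - 1).choose k = (#V - 2).choose k + D := by simpa [hm] using hD
      simp only [hm, show m + 2 + 1 - (s + 1) = m + 2 - s by omega] at hcard
      have hI i (hi : i ∈ I) : #(I.erase i) = s := by rw [card_erase_of_mem hi, hs]; rfl
      -- a vertex of very large degree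
      by_cases hbig : ∃ i ∈ I, ∃ v ∈ V, (k + 1) * s * D < #{e ∈ F i | v ∈ e}
      · obtain ⟨i, hi, v, hv, hdeg⟩ := hbig
        refine .of_large_degree hF hDV hi hv (by simpa [hs] using hdeg) ?_
        have hVv : #(V.erase v) = m + 1 := by rw [card_erase_of_mem hv, hm]; rfl
        refine ihs _ (V.erase v) _ ?_ (fun j hj e he => ?_) (fun j hj => ?_) (hI i hi)
        · rw [hVv, hI i hi]
          nlinarith
        · obtain ⟨he, hve⟩ := mem_filter.1 he
          have := mem_powersetCard.1 (hF j (mem_of_mem_erase hj) he)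
          exact mem_powersetCard.2 ⟨subset_erase.2 ⟨this.1, hve⟩, this.2⟩
        · have hj := mem_of_mem_erase hj
          have h1 := hcard j hj
          have h2 := card_filter_mem_le (hF j hj) hv
          have h3 := card_filter_add_card_filter_not (s := F j) (fun e => v ∈ e)
          rw [hVv, hI i hi]
          rw [hm] at h2
          rw [Nat.choose_succ_succ] at h1
          simp only [Nat.succ_eq_add_one,
            show m + 2 - 1 = m + 1 by omega, show m + 1 + 1 - s = m + 2 - s by omega] at *
          omega
      push Not at hbig
      by_cases hfew : ∃ i ∈ I, #{v ∈ V | 2 * s * D < #{e ∈ F i | v ∈ e}} ≤ s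
      · obtain ⟨i, hi, hheavy⟩ := hfew
        have hs' : #I - 1 = s := by omega
        refine .of_few_heavy (D := D) hF hi (by simpa [hs'] using hbig i hi)
          (by simpa [hs'] using hheavy) ?_ ?_
        · rw [hs']
          have h1 := choose_succ_add_mul_choose_le (m + 2 - s) k s
          rw [show m + 2 - s + s = m + 2 by omega] at h1
          have h2 := Nat.mul_le_mul_right s (three_mul_mul_le_choose hD hV)
          have h3 := hcard i hi
          rw [mul_comm s] at h1
          omega
        · refine ihs _ V F ?_ (fun j hj => hF j (mem_of_mem_erase hj)) (fun j hj => ?_)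
            (hI i hi)
          · rw [hI i hi, hm]
            nlinarith
          · rw [hI i hi, hm]
            exact (hcard j (mem_of_mem_erase hj)).trans_le
              (Nat.add_le_add_left (Nat.choose_le_choose _ (by omega)) _)
      push Not at hfew
      -- every family has many vertices of large degree: pass to links
      obtain ⟨x, -⟩ := card_pos.1 (show 0 < #V by omega)
      have : Nonempty α := ⟨x⟩
      obtain ⟨v, hvH, hinj⟩ := exists_injOn_of_card_le I _ (fun i hi => hs.trans_le (hfew i hi))
      have hS : I.image v ⊆ V := image_subset_iff.2 fun i hi => (mem_filter.1 (hvH i hi)).1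
      have hcS : #(I.image v) = s + 1 := by rw [card_image_of_injOn hinj, hs]
      have hcW : #(V \ I.image v) = m + 1 - s := by
        rw [card_sdiff_of_subset hS, hcS, hm]; omega
      refine .of_exactLink hinj (ihk I (V \ I.image v) _ ?_
        (fun i hi => exactLink_subset (hF i hi) _) fun i hi => ?_)
      · rw [hcW, hs, Nat.lt_sub_iff_add_lt]
        nlinarith [Nat.zero_le (k * (s + 1))]
      · have h1 := card_filter_mem_le_card_exactLink_add (hF i hi) hDV hS (mem_image_of_mem v hi)
        have h2 := (mem_filter.1 (hvH i hi)).2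
        have h3 := choose_add_le_of_choose_succ_eq hD (m + 1 - s - s) s (by omega)
        rw [hcS, Nat.add_sub_cancel] at h1
        rw [hcW, hs, show m + 1 - s + 1 - (s + 1) = m + 1 - s - s by omega]
        rw [show m + 1 - s - s + s = m + 1 - s by omega] at h3
        rw [mul_assoc] at h2
        omega

end Families

/-- Theorem of Huang, Loh, and Sudakov: if `n > 3k²t` and each `F_i ⊆ C([n],k)`
satisfies `|F_i| > C(n,k) - C(n-t+1,k)`, then `{F₁,…,F_t}` admits a rainbow matching. -/
theorem stmt_14 (n k t : ℕ) (hn : 0 < n) (hk : 0 < k) (ht : 0 < t)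
    (hnkt : 3 * k ^ 2 * t < n)
    (F : Fin t → Finset (Finset (Fin n)))
    (hF : ∀ i, F i ⊆ Finset.univ.powersetCard k)
    (hFcard : ∀ i, Nat.choose n k - Nat.choose (n - t + 1) k < (F i).card) :
    ∃ e : Fin t → Finset (Fin n),
      (∀ i, e i ∈ F i) ∧ ∀ i j, i ≠ j → Disjoint (e i) (e j) := by
  have htn : t ≤ n := by nlinarith [Nat.pow_le_pow_left hk 2]
  obtain ⟨e, he, hd⟩ := hasRainbowMatching_of_choose_lt k univ univ F
    (by simpa using hnkt) (fun i _ => hF i) fun i _ => by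
      have := hFcard i
      simp only [card_univ, Fintype.card_fin]
      rw [show n + 1 - t = n - t + 1 by omega]
      omega
  exact ⟨e, fun i => he i (mem_univ i), fun i j hij => hd (by simp) (by simp) hij⟩
end

section
/- Let n, k, t be positive integers with n ≥ (2t−1)k − (t−1). If H is a k-graph on vertex set [n] with ν(H) < t (i.e., H contains no t pairwise disjoint edges), then e(H) ≤ C(n,k) − C(n−t+1,k). -/
open Finset
open scoped FinsetFamily

/-- There are no `t` pairwise disjoint members of the family `F`. -/
def MatchingFree {α : Type*} (F : Finset (Finset α)) (t : ℕ) : Prop :=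
  ∀ f : Fin t → Finset α, (∀ i, f i ∈ F) → ¬ Pairwise (Function.onFun Disjoint f)

/-- The family `F` is stable under replacing an element by a smaller one that is at least `a`. -/
def IsShifted (a : ℕ) (F : Finset (Finset ℕ)) : Prop :=
  ∀ A ∈ F, ∀ i j, a ≤ i → i < j → j ∈ A → i ∉ A → insert i (A.erase j) ∈ F

theorem MatchingFree.mono {α : Type*} {F G : Finset (Finset α)} {t : ℕ}
    (h : MatchingFree G t) (hFG : F ⊆ G) : MatchingFree F t :=
  fun f hf => h f fun i => hFG (hf i)

/-- The `(i, j)`-shift of a single member of the family `F`. -/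
def shiftMember (F : Finset (Finset ℕ)) (i j : ℕ) (A : Finset ℕ) : Finset ℕ :=
  if j ∈ A ∧ i ∉ A ∧ insert i (A.erase j) ∉ F then insert i (A.erase j) else A

theorem insert_erase_insert_erase {i j : ℕ} {A : Finset ℕ} (hj : j ∈ A) (hi : i ∉ A) :
    insert j ((insert i (A.erase j)).erase i) = A := by
  ext x
  simp only [mem_insert, mem_erase]
  grind

theorem shiftMember_injOn (F : Finset (Finset ℕ)) (i j : ℕ) :
    Set.InjOn (shiftMember F i j) F := by
  intro A hA B hB hAB
  simp only [mem_coe] at hA hB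
  unfold shiftMember at hAB
  split_ifs at hAB with h1 h2 h2
  · rw [← insert_erase_insert_erase h1.1 h1.2.1, hAB, insert_erase_insert_erase h2.1 h2.2.1]
  · exact absurd (hAB ▸ hB) h1.2.2
  · exact absurd (hAB ▸ hA) h2.2.2
  · exact hAB

theorem MatchingFree.image_shiftMember {F : Finset (Finset ℕ)} {t : ℕ} (h : MatchingFree F t)
    (i j : ℕ) : MatchingFree (F.image (shiftMember F i j)) t := by
  intro f hf hd
  by_cases hall : ∀ a, f a ∈ F
  · exact h f hall hd
  push Not at hall
  obtain ⟨a, ha⟩ := hall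
  have hswap : ∀ A : Finset ℕ, j ∈ A → i ∉ A →
      A.map (Equiv.swap i j).toEmbedding = insert i (A.erase j) := by
    intro A hj hi
    ext x
    simp only [mem_map_equiv, Equiv.symm_swap, mem_insert, mem_erase, Equiv.swap_apply_def]
    grind
  have hfix : ∀ A : Finset ℕ, j ∉ A → i ∉ A →
      A.map (Equiv.swap i j).toEmbedding = A := by
    intro A hj hi
    ext x
    simp only [mem_map_equiv, Equiv.symm_swap, Equiv.swap_apply_def]
    grind
  have hinv : ∀ A : Finset ℕ,
      (A.map (Equiv.swap i j).toEmbedding).map (Equiv.swap i j).toEmbedding = A := by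
    intro A
    ext x
    simp only [mem_map_equiv, Equiv.symm_swap, Equiv.swap_apply_self]
  obtain ⟨A, hA, hAa⟩ := mem_image.1 (hf a)
  have hcond : j ∈ A ∧ i ∉ A ∧ insert i (A.erase j) ∉ F := by
    by_contra hc
    rw [shiftMember, if_neg hc] at hAa
    exact ha (hAa ▸ hA)
  rw [shiftMember, if_pos hcond] at hAa
  have hia : i ∈ f a := by rw [← hAa]; simp
  refine h (fun b => (f b).map (Equiv.swap i j).toEmbedding) (fun b => ?_) ?_
  · by_cases hb : b = a
    · subst hb
      rw [← hAa, ← hswap A hcond.1 hcond.2.1, hinv]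
      exact hA
    · have hib : i ∉ f b := fun hib => disjoint_left.1 (hd hb) hib hia
      obtain ⟨B, hB, hBb⟩ := mem_image.1 (hf b)
      have hBcond : ¬ (j ∈ B ∧ i ∉ B ∧ insert i (B.erase j) ∉ F) := by
        intro hc
        rw [shiftMember, if_pos hc] at hBb
        exact hib (by rw [← hBb]; simp)
      rw [shiftMember, if_neg hBcond] at hBb
      subst hBb
      by_cases hjb : j ∈ f b
      · show (f b).map _ ∈ F
        rw [hswap _ hjb hib]
        by_contra hc
        exact hBcond ⟨hjb, hib, hc⟩
      · show (f b).map _ ∈ F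
        rw [hfix _ hjb hib]
        exact hB
  · intro b c hbc
    exact (disjoint_map _).2 (hd hbc)

/-- Every uniform matching-free family can be replaced by a shifted one of the same size. -/
theorem exists_isShifted {n k t : ℕ} (F : Finset (Finset ℕ)) (hF : F ⊆ powersetCard k (range n))
    (hfree : MatchingFree F t) :
    ∃ G ⊆ powersetCard k (range n), #G = #F ∧ MatchingFree G t ∧ IsShifted 0 G := by
  induction hw : ∑ A ∈ F, ∑ x ∈ A, x using Nat.strong_induction_on generalizing F with
  | _ w ih =>
    by_cases hs : IsShifted 0 F
    · exact ⟨F, hF, rfl, hfree, hs⟩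
    unfold IsShifted at hs
    push Not at hs
    obtain ⟨A, hA, i, j, -, hij, hj, hi, hAF⟩ := hs
    have hsum : ∀ B : Finset ℕ, j ∈ B → i ∉ B →
        ∑ x ∈ insert i (B.erase j), x < ∑ x ∈ B, x := by
      intro B hjB hiB
      rw [sum_insert (by simp [hiB]), ← add_sum_erase B (fun x => x) hjB]
      omega
    obtain ⟨G, hG, hcard, hGfree, hGs⟩ := ih (∑ A ∈ F.image (shiftMember F i j), ∑ x ∈ A, x)
      (by
        rw [← hw, sum_image (shiftMember_injOn F i j)]
        refine sum_lt_sum (fun B hB => ?_) ⟨A, hA, ?_⟩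
        · unfold shiftMember
          split_ifs with hc
          · exact (hsum B hc.1 hc.2.1).le
          · exact le_rfl
        · rw [shiftMember, if_pos ⟨hj, hi, hAF⟩]
          exact hsum A hj hi)
      (F.image (shiftMember F i j))
      (by
        intro B hB
        obtain ⟨C, hC, rfl⟩ := mem_image.1 hB
        have hCF := hF hC
        unfold shiftMember
        split_ifs with hc
        · rw [mem_powersetCard] at hCF ⊢
          refine ⟨?_, ?_⟩
          · have := mem_range.1 (hCF.1 hc.1)
            refine insert_subset (mem_range.2 (by omega)) ((erase_subset _ _).trans hCF.1)
          · rw [card_insert_of_notMem (by simp [hc.2.1]), card_erase_add_one hc.1, hCF.2]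
        · exact hCF)
      (hfree.image_shiftMember i j) rfl
    exact ⟨G, hG, hcard.trans (card_image_of_injOn (shiftMember_injOn F i j)), hGfree, hGs⟩

/-- The local LYM inequality on a ground set too small to hold `s + 1` disjoint members. -/
theorem card_le_mul_card_shadow_of_card_lt {a n k s : ℕ} {F : Finset (Finset ℕ)}
    (hF : F ⊆ powersetCard (k + 1) (Ico a n)) (hn : n < a + (s + 1) * (k + 1)) :
    #F ≤ s * #(∂ F) := by
  have key : #F * (k + 1) ≤ #(∂ F) * (s * (k + 1)) := by
    refine card_mul_le_card_mul (fun A B => B ⊆ A) (fun A hA => ?_) (fun B hB => ?_)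
    · have hc := (mem_powersetCard.1 (hF hA)).2
      rw [← hc]
      refine card_le_card_of_injOn (fun x => A.erase x) (fun x hx => ?_) (fun x hx y hy hxy => ?_)
      · simp only [coe_bipartiteAbove, Set.mem_ofPred_eq]
        exact ⟨erase_mem_shadow hA hx, erase_subset _ _⟩
      · exact erase_injOn A hx hy hxy
    · obtain ⟨A, hA, x, hx, rfl⟩ := mem_shadow_iff.1 hB
      have hA' := mem_powersetCard.1 (hF hA)
      have hsub : bipartiteBelow (fun A B => B ⊆ A) F (A.erase x) ⊆
          (Ico a n \ A.erase x).image (fun y => insert y (A.erase x)) := by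
        intro C hC
        obtain ⟨hCF, hAC⟩ := mem_bipartiteBelow _ |>.1 hC
        have hC' := mem_powersetCard.1 (hF hCF)
        have h1 : #(C \ A.erase x) = 1 := by
          have := card_sdiff_add_card_eq_card hAC
          have := card_erase_add_one hx
          omega
        obtain ⟨y, hy⟩ := card_eq_one.1 h1
        have hyC : y ∈ C \ A.erase x := by rw [hy]; simp
        refine mem_image.2 ⟨y, ?_, ?_⟩
        · exact mem_sdiff.2 ⟨hC'.1 (mem_sdiff.1 hyC).1, (mem_sdiff.1 hyC).2⟩
        · rw [insert_eq, ← hy, sdiff_union_of_subset hAC]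
      refine (card_le_card hsub).trans (card_image_le.trans ?_)
      have h2 := card_sdiff_add_card_eq_card ((erase_subset x A).trans hA'.1)
      have h3 := card_erase_add_one hx
      rw [Nat.card_Ico] at h2
      have : (s + 1) * (k + 1) = s * (k + 1) + (k + 1) := by ring
      omega
  rw [← mul_assoc] at key
  rw [mul_comm s]
  exact Nat.le_of_mul_le_mul_right key (Nat.succ_pos k)

theorem MatchingFree.memberSubfamily {a n k s : ℕ} {F : Finset (Finset ℕ)}
    (hF : F ⊆ powersetCard (k + 1) (Ico a (n + 1))) (hs : IsShifted a F)
    (hfree : MatchingFree F (s + 1)) (hn : a + (s + 1) * (k + 1) ≤ n + 1) :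
    MatchingFree (F.memberSubfamily n) (s + 1) := by
  intro f hf hd
  have hf' : ∀ i, insert n (f i) ∈ F ∧ n ∉ f i := fun i => mem_memberSubfamily.1 (hf i)
  have hcard : ∀ i, #(f i) = k := by
    intro i
    have := (mem_powersetCard.1 (hF (hf' i).1)).2
    rw [card_insert_of_notMem (hf' i).2] at this
    omega
  set R := Ico a (n + 1) \ univ.biUnion f with hR
  have hRcard : Fintype.card (Fin (s + 1)) ≤ #R := by
    have h1 : #(univ.biUnion f) ≤ (s + 1) * k := by
      refine card_biUnion_le.trans ?_
      simp [hcard]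
    have h2 := le_card_sdiff (univ.biUnion f) (Ico a (n + 1))
    rw [Nat.card_Ico, ← hR] at h2
    rw [Fintype.card_fin]
    have : (s + 1) * (k + 1) = (s + 1) * k + (s + 1) := by ring
    omega
  obtain ⟨x, hx⟩ : ∃ x : Fin (s + 1) ↪ ℕ, ∀ i, x i ∈ R := by
    rw [← Fintype.card_coe R] at hRcard
    obtain ⟨e⟩ := Function.Embedding.nonempty_of_card_le hRcard
    exact ⟨e.trans (Function.Embedding.subtype _), fun i => (e i).2⟩
  have hxf : ∀ i j, x i ∉ f j := fun i j hij =>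
    (mem_sdiff.1 (hx i)).2 (mem_biUnion.2 ⟨j, mem_univ _, hij⟩)
  refine hfree (fun i => insert (x i) (f i)) (fun i => ?_) ?_
  · have hxi := mem_Ico.1 (mem_sdiff.1 (hx i)).1
    by_cases hxn : x i = n
    · rw [hxn]; exact (hf' i).1
    · have := hs _ (hf' i).1 (x i) n hxi.1 (by omega) (mem_insert_self _ _)
        (by simp [hxn, hxf])
      rwa [erase_insert (hf' i).2] at this
  · intro i j hij
    have := hd hij
    simp only [Function.onFun] at this ⊢
    rw [disjoint_insert_left, disjoint_insert_right]
    refine ⟨?_, hxf j i, this⟩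
    simp [hxf, hij]

/-- A shifted uniform family without `s + 1` disjoint members is at most `s` times as large as
its shadow. -/
theorem card_le_mul_card_shadow {a n k s : ℕ} {F : Finset (Finset ℕ)}
    (hF : F ⊆ powersetCard (k + 1) (Ico a n)) (hs : IsShifted a F)
    (hfree : MatchingFree F (s + 1)) : #F ≤ s * #(∂ F) := by
  induction n generalizing k F with
  | zero => exact card_le_mul_card_shadow_of_card_lt hF (by positivity)
  | succ n ih =>
    rcases lt_or_ge (n + 1) (a + (s + 1) * (k + 1)) with hn | hn
    · exact card_le_mul_card_shadow_of_card_lt hF hn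
    rcases F.eq_empty_or_nonempty with rfl | ⟨A₀, hA₀⟩
    · simp
    rcases k with _ | k
    · have hone : 1 ≤ #(∂ F) := by
        have hc := (mem_powersetCard.1 (hF hA₀)).2
        obtain ⟨x, hx⟩ : A₀.Nonempty := card_pos.1 (by omega)
        exact card_pos.2 ⟨_, erase_mem_shadow hA₀ hx⟩
      have hle : #F ≤ s := by
        by_contra! hlt
        obtain ⟨e⟩ : Nonempty (Fin (s + 1) ↪ F) :=
          Function.Embedding.nonempty_of_card_le (by simpa using hlt)
        refine hfree (fun i => e i) (fun i => (e i).2) (fun i j hij => ?_)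
        obtain ⟨x, hx⟩ := card_eq_one.1 (mem_powersetCard.1 (hF (e i).2)).2
        obtain ⟨y, hy⟩ := card_eq_one.1 (mem_powersetCard.1 (hF (e j).2)).2
        have hne : (e i : Finset ℕ) ≠ e j := fun h => hij (e.injective (Subtype.ext h))
        simp only [Function.onFun]
        rw [hx, hy] at hne ⊢
        simpa using hne
      nlinarith
    · have hn' : ∀ A ⊆ Ico a (n + 1), n ∉ A → A ⊆ Ico a n := by
        intro A hA hnA x hx
        have h1 := mem_Ico.1 (hA hx)
        have : x ≠ n := fun h => hnA (h ▸ hx)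
        exact mem_Ico.2 ⟨h1.1, by omega⟩
      have h1 : #(F.memberSubfamily n) ≤ s * #(∂ (F.memberSubfamily n)) := by
        refine ih (k := k) (fun A hA => ?_) (fun A hA i j hi hij hj hiA => ?_)
          (hfree.memberSubfamily hF hs hn)
        · obtain ⟨hA, hnA⟩ := mem_memberSubfamily.1 hA
          have hA' := mem_powersetCard.1 (hF hA)
          rw [card_insert_of_notMem hnA] at hA'
          exact mem_powersetCard.2
            ⟨hn' A ((subset_insert _ _).trans hA'.1) hnA, by omega⟩
        · obtain ⟨hA, hnA⟩ := mem_memberSubfamily.1 hA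
          have hjn := mem_Ico.1 ((mem_powersetCard.1 (hF hA)).1 (mem_insert_of_mem hj))
          have hjn' : j ≠ n := fun h => hnA (h ▸ hj)
          have hin : i ≠ n := by omega
          rw [mem_memberSubfamily]
          refine ⟨?_, by simp [hnA, hin.symm]⟩
          have := hs _ hA i j hi hij (mem_insert_of_mem hj) (by simp [hin, hiA])
          rwa [erase_insert_of_ne hjn'.symm, Finset.insert_comm] at this
      have h2 : #(F.nonMemberSubfamily n) ≤ s * #(∂ (F.nonMemberSubfamily n)) := by
        refine ih (k := k + 1) (fun A hA => ?_) (fun A hA i j hi hij hj hiA => ?_)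
          (hfree.mono (filter_subset _ _))
        · obtain ⟨hA, hnA⟩ := mem_nonMemberSubfamily.1 hA
          have hA' := mem_powersetCard.1 (hF hA)
          exact mem_powersetCard.2 ⟨hn' A hA'.1 hnA, hA'.2⟩
        · obtain ⟨hA, hnA⟩ := mem_nonMemberSubfamily.1 hA
          have hjn := mem_Ico.1 ((mem_powersetCard.1 (hF hA)).1 hj)
          rw [mem_nonMemberSubfamily]
          refine ⟨hs _ hA i j hi hij hj hiA, ?_⟩
          have hin : n ≠ i := by omega
          simp [hnA, hin]
      have h3 : ∂ (F.memberSubfamily n) ⊆ (∂ F).memberSubfamily n := by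
        intro B hB
        obtain ⟨A, hA, x, hx, rfl⟩ := mem_shadow_iff.1 hB
        obtain ⟨hA, hnA⟩ := mem_memberSubfamily.1 hA
        have hxn : x ≠ n := fun h => hnA (h ▸ hx)
        rw [mem_memberSubfamily, ← erase_insert_of_ne hxn.symm]
        exact ⟨erase_mem_shadow hA (mem_insert_of_mem hx), fun h => hnA (mem_of_mem_erase h)⟩
      have h4 : ∂ (F.nonMemberSubfamily n) ⊆ (∂ F).nonMemberSubfamily n := by
        intro B hB
        obtain ⟨A, hA, x, hx, rfl⟩ := mem_shadow_iff.1 hB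
        obtain ⟨hA, hnA⟩ := mem_nonMemberSubfamily.1 hA
        exact mem_nonMemberSubfamily.2
          ⟨erase_mem_shadow hA hx, fun h => hnA (mem_of_mem_erase h)⟩
      rw [← card_memberSubfamily_add_card_nonMemberSubfamily n F,
        ← card_memberSubfamily_add_card_nonMemberSubfamily n (∂ F), mul_add]
      exact add_le_add (h1.trans (Nat.mul_le_mul_left _ (card_le_card h3)))
        (h2.trans (Nat.mul_le_mul_left _ (card_le_card h4)))

/-- A weighted bound for a nested sequence of `s + 1` subsets of a set of size `2 * s + 1` with no
system of distinct representatives. -/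
theorem sum_card_add_mul_card_last_le {s : ℕ} (X : Fin (s + 1) → Finset (Fin (2 * s + 1)))
    (hX : Antitone X)
    (hinj : ¬ ∃ f : Fin (s + 1) → Fin (2 * s + 1), Function.Injective f ∧ ∀ i, f i ∈ X i) :
    ∑ i, #(X i) + s * #(X (Fin.last s)) ≤ s * (2 * s + 1) := by
  rw [← all_card_le_biUnion_card_iff_exists_injective] at hinj
  push Not at hinj
  obtain ⟨S, hS⟩ := hinj
  have hne : S.Nonempty := by
    rw [nonempty_iff_ne_empty]
    rintro rfl
    simp at hS
  set j := S.min' hne with hj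
  have hXj : #(X j) ≤ s - j := by
    have h1 : #(X j) ≤ #(S.biUnion X) :=
      card_le_card (subset_biUnion_of_mem X (S.min'_mem hne))
    have h2 : #S ≤ #(Ici j) := card_le_card fun i hi => mem_Ici.2 (S.min'_le i hi)
    rw [Fin.card_Ici] at h2
    omega
  have hjs : (j : ℕ) ≤ s := Nat.lt_succ_iff.1 j.2
  have hbound : ∀ i, #(X i) ≤ if (i : ℕ) < j then 2 * s + 1 else s - j := by
    intro i
    split_ifs with hi
    · simpa using card_le_univ (X i)
    · exact (card_le_card (hX (not_lt.1 hi))).trans hXj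
  have hlast : #(X (Fin.last s)) ≤ s - j := (card_le_card (hX (Fin.le_last j))).trans hXj
  have hsum : ∑ i, #(X i) ≤ j * (2 * s + 1) + (s + 1 - j) * (s - j) := by
    refine (sum_le_sum fun i _ => hbound i).trans ?_
    rw [Fin.sum_univ_eq_sum_range (fun i => if i < (j : ℕ) then 2 * s + 1 else s - j) (s + 1),
      sum_ite, sum_const, sum_const, smul_eq_mul, smul_eq_mul]
    have h1 : (range (s + 1)).filter (· < (j : ℕ)) = range j := by
      ext x; simp only [mem_filter, mem_range]; omega
    have h2 : (range (s + 1)).filter (fun x => ¬ x < (j : ℕ)) = Ico (j : ℕ) (s + 1) := by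
      ext x; simp only [mem_filter, mem_range, mem_Ico]; omega
    rw [h1, h2, card_range, Nat.card_Ico]
  generalize (j : ℕ) = j' at *
  obtain ⟨d, rfl⟩ := Nat.exists_eq_add_of_le hjs
  have e1 : j' + d + 1 - j' = d + 1 := by omega
  have e2 : j' + d - j' = d := by omega
  rw [e1, e2] at hsum
  rw [e2] at hlast
  nlinarith [Nat.mul_le_mul_left (j' + d) hlast]

theorem exists_perm_map_eq {α : Type*} [Fintype α] [DecidableEq α] {A B : Finset α}
    (h : #A = #B) : ∃ τ : Equiv.Perm α, A.map τ.toEmbedding = B := by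
  let e : {x // x ∈ A} ≃ {x // x ∈ B} := Finset.equivOfCardEq h
  refine ⟨e.extendSubtype, eq_of_subset_of_card_le (fun x hx => ?_) (by simp [h])⟩
  obtain ⟨y, hy, rfl⟩ := mem_map.1 hx
  exact e.extendSubtype_mem y hy

/-- A uniformly random permutation maps a fixed `l`-set to a uniformly random `l`-set. -/
theorem card_perm_map_mem_mul_choose {α : Type*} [Fintype α] [DecidableEq α] {l : ℕ}
    {B : Finset α} (hB : #B = l) {F : Finset (Finset α)} (hF : ∀ A ∈ F, #A = l) :
    #{σ : Equiv.Perm α | B.map σ.toEmbedding ∈ F} * (Fintype.card α).choose l =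
      #F * (Fintype.card α).factorial := by
  have hfib : ∀ A : Finset α, #A = l →
      #{σ : Equiv.Perm α | B.map σ.toEmbedding = A} =
        #{σ : Equiv.Perm α | B.map σ.toEmbedding = B} := by
    intro A hA
    obtain ⟨τ, hτ⟩ := exists_perm_map_eq (hA.trans hB.symm)
    refine card_equiv (Equiv.mulLeft τ) fun σ => ?_
    have hmul : B.map (τ * σ).toEmbedding =
        (B.map σ.toEmbedding).map τ.toEmbedding := by
      rw [map_map]; rfl
    simp only [mem_filter, mem_univ, true_and, Equiv.coe_mulLeft, hmul]
    rw [← map_inj (f := τ.toEmbedding), hτ]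
  have hcount : ∀ G : Finset (Finset α), (∀ A ∈ G, #A = l) →
      #{σ : Equiv.Perm α | B.map σ.toEmbedding ∈ G} =
        #G * #{σ : Equiv.Perm α | B.map σ.toEmbedding = B} := by
    intro G hG
    rw [card_eq_sum_card_fiberwise (f := fun σ : Equiv.Perm α => B.map σ.toEmbedding) (t := G)
      (fun σ hσ => by simpa using hσ), ← smul_eq_mul, ← sum_const]
    refine sum_congr rfl fun A hA => ?_
    rw [← hfib A (hG A hA), filter_filter]
    congr 1
    ext σ
    simp only [mem_filter, mem_univ, true_and]
    exact ⟨fun h => h.2, fun h => ⟨h ▸ hA, h⟩⟩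
  have htotal := hcount (powersetCard l univ) (fun A hA => (mem_powersetCard.1 hA).2)
  rw [card_powersetCard, filter_true_of_mem (fun σ _ => by simp [hB]), card_univ,
    Fintype.card_perm, card_univ] at htotal
  rw [hcount F hF, htotal]
  ring

/-- A weighted bound for nested cross-dependent `l`-uniform families, obtained by averaging over
all placements of `2 * s + 1` disjoint `l`-sets. -/
theorem sum_card_add_mul_card_last_le_choose {α : Type*} [Fintype α] [DecidableEq α]
    {s l : ℕ} (hα : (2 * s + 1) * l ≤ Fintype.card α) (F : Fin (s + 1) → Finset (Finset α))
    (hanti : Antitone F) (hF : ∀ i, ∀ A ∈ F i, #A = l)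
    (hcross : ∀ f : Fin (s + 1) → Finset α, (∀ i, f i ∈ F i) →
      ¬ Pairwise (Function.onFun Disjoint f)) :
    ∑ i, #(F i) + s * #(F (Fin.last s)) ≤ s * (Fintype.card α).choose l := by
  obtain ⟨e⟩ : Nonempty (Fin (2 * s + 1) × Fin l ↪ α) :=
    Function.Embedding.nonempty_of_card_le (by simpa using hα)
  let B : Fin (2 * s + 1) → Finset α := fun j =>
    univ.map ⟨fun x => e (j, x), fun x y h => by simpa using e.injective h⟩
  have hBcard : ∀ j, #(B j) = l := fun j => by simp [B]
  have hBdisj : Pairwise (Function.onFun Disjoint B) := by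
    intro i j hij
    simp only [Function.onFun, disjoint_left, B, mem_map, mem_univ, true_and,
      not_exists]
    rintro _ ⟨x, rfl⟩ y hxy
    exact hij (by simpa using (congrArg Prod.fst (e.injective hxy)).symm)
  let X : Equiv.Perm α → Fin (s + 1) → Finset (Fin (2 * s + 1)) := fun σ i =>
    {j | (B j).map σ.toEmbedding ∈ F i}
  have hX : ∀ σ, ∑ i, #(X σ i) + s * #(X σ (Fin.last s)) ≤ s * (2 * s + 1) := by
    intro σ
    refine sum_card_add_mul_card_last_le (X σ) (fun i j hij x hx => ?_) ?_
    · simp only [X, mem_filter, mem_univ, true_and] at hx ⊢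
      exact hanti hij hx
    · rintro ⟨f, hf, hfX⟩
      refine hcross (fun i => (B (f i)).map σ.toEmbedding) (fun i => ?_) (fun i j hij => ?_)
      · simpa [X] using hfX i
      · exact (disjoint_map _).2 (hBdisj (hf.ne hij))
  have hsumX : ∀ i, (∑ σ, #(X σ i)) * (Fintype.card α).choose l =
      (2 * s + 1) * (Fintype.card α).factorial * #(F i) := by
    intro i
    have hswap : ∑ σ, #(X σ i) =
        ∑ j, #{σ : Equiv.Perm α | (B j).map σ.toEmbedding ∈ F i} := by
      simp only [X, card_filter]
      exact sum_comm
    rw [hswap, sum_mul, sum_congr rfl fun j _ => card_perm_map_mem_mul_choose (hBcard j) (hF i)]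
    simp
    ring
  have htotal := sum_le_sum fun σ (_ : σ ∈ univ) => hX σ
  rw [sum_add_distrib, sum_comm, ← mul_sum, sum_const, card_univ, Fintype.card_perm,
    smul_eq_mul] at htotal
  have hmul := Nat.mul_le_mul_right ((Fintype.card α).choose l) htotal
  rw [add_mul, sum_mul, sum_congr rfl fun i _ => hsumX i, mul_assoc s, hsumX, ← mul_sum] at hmul
  refine le_of_mul_le_mul_left (a := (2 * s + 1) * (Fintype.card α).factorial) ?_
    (Nat.mul_pos (Nat.succ_pos _) (Nat.factorial_pos _))
  linarith

/-- The matching bound for shifted families. -/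
theorem IsShifted.card_add_choose_le {m k s : ℕ} {G : Finset (Finset ℕ)} (hs : IsShifted 0 G)
    (hG : G ⊆ powersetCard (k + 1) (range (m + s + 1))) (hfree : MatchingFree G (s + 1))
    (hm : (2 * s + 1) * k ≤ m) :
    #G + (m + 1).choose (k + 1) ≤ (m + s + 1).choose (k + 1) := by
  set S := Ico (s + 1) (m + s + 1) with hS
  have hScard : #S = m := by rw [hS, Nat.card_Ico]; omega
  let ι : {x // x ∈ S} ↪ ℕ := Function.Embedding.subtype (· ∈ S)
  have hι : ∀ (A : Finset {x // x ∈ S}), ∀ x ∈ A.map ι, s < x ∧ x < m + s + 1 := by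
    intro A x hx
    obtain ⟨y, -, rfl⟩ := mem_map.1 hx
    have := mem_Ico.1 y.2
    exact ⟨by simpa [ι] using this.1, this.2⟩
  have hhead : ∀ (A : Finset {x // x ∈ S}) (i : Fin (s + 1)), (i : ℕ) ∉ A.map ι := by
    intro A i hi
    have := hι A i hi
    omega
  let L : Fin (s + 1) → Finset (Finset {x // x ∈ S}) := fun i =>
    {A ∈ powersetCard k univ | insert (i : ℕ) (A.map ι) ∈ G}
  have hLmem : ∀ i A, A ∈ L i ↔ #A = k ∧ insert (i : ℕ) (A.map ι) ∈ G := by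
    intro i A; simp only [L, mem_filter, mem_powersetCard_univ]
  have hLanti : Antitone L := by
    intro i j hij A hA
    rcases hij.eq_or_lt with rfl | hij
    · exact hA
    rw [hLmem] at hA ⊢
    refine ⟨hA.1, ?_⟩
    have := hs _ hA.2 i j (Nat.zero_le _) hij (mem_insert_self _ _)
      (by rw [mem_insert, not_or]; exact ⟨fun h => hij.ne (Fin.ext h), hhead A i⟩)
    rwa [erase_insert (hhead A j)] at this
  have hL : ∑ i, #(L i) + s * #(L (Fin.last s)) ≤ s * m.choose k := by
    have hcard : Fintype.card {x // x ∈ S} = m := by rw [Fintype.card_coe, hScard]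
    have := sum_card_add_mul_card_last_le_choose (l := k) (hm.trans hcard.ge) L hLanti
      (fun i A hA => ((hLmem i A).1 hA).1) (fun f hf hd => ?_)
    · rwa [hcard] at this
    · refine hfree (fun i => insert (i : ℕ) ((f i).map ι)) (fun i => ((hLmem _ _).1 (hf i)).2)
        (fun i j hij => ?_)
      have hd' : Disjoint ((f i).map ι) ((f j).map ι) := (disjoint_map _).2 (hd hij)
      simp only [Function.onFun]
      rw [disjoint_insert_left, disjoint_insert_right, mem_insert, not_or]
      exact ⟨⟨fun h => hij (Fin.ext h), hhead _ _⟩, hhead _ _, hd'⟩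
  have hG0 : #(powersetCard (k + 1) S ∩ G) ≤ s * #(∂ (powersetCard (k + 1) S ∩ G)) := by
    refine card_le_mul_card_shadow (a := s + 1) (n := m + s + 1) inter_subset_left ?_
      (hfree.mono inter_subset_right)
    intro A hA i j hi hij hj hiA
    obtain ⟨hAS, hAG⟩ := mem_inter.1 hA
    obtain ⟨hAS, hAc⟩ := mem_powersetCard.1 hAS
    refine mem_inter.2 ⟨mem_powersetCard.2 ⟨insert_subset ?_ ((erase_subset _ _).trans hAS), ?_⟩,
      hs A hAG i j (Nat.zero_le _) hij hj hiA⟩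
    · have := mem_Ico.1 (hAS hj)
      exact mem_Ico.2 ⟨hi, by omega⟩
    · rw [card_insert_of_notMem (by simp [hiA]), card_erase_add_one hj, hAc]
  have hshadow : #(∂ (powersetCard (k + 1) S ∩ G)) ≤ #(L (Fin.last s)) := by
    refine (card_le_card (t := (L (Fin.last s)).image (fun A => A.map ι)) ?_).trans card_image_le
    intro B hB
    obtain ⟨A, hA, x, hx, rfl⟩ := mem_shadow_iff.1 hB
    obtain ⟨hAS, hAG⟩ := mem_inter.1 hA
    obtain ⟨hAS, hAc⟩ := mem_powersetCard.1 hAS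
    have hmap : ((A.erase x).subtype (· ∈ S)).map ι = A.erase x :=
      subtype_map_of_mem fun y hy => hAS (mem_of_mem_erase hy)
    refine mem_image.2 ⟨(A.erase x).subtype (· ∈ S), (hLmem _ _).2 ⟨?_, ?_⟩, hmap⟩
    · rw [← card_map ι, hmap, card_erase_of_mem hx, hAc, Nat.add_sub_cancel]
    · rw [hmap]
      have hxS := mem_Ico.1 (hAS hx)
      refine hs A hAG _ x (Nat.zero_le _) (by simpa using hxS.1) hx fun h => ?_
      have := mem_Ico.1 (hAS h)
      simp at this
  let N : Fin (s + 1) → Finset (Finset ℕ) := fun i =>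
    (powersetCard k univ \ L i).image (fun A => insert (i : ℕ) (A.map ι))
  have hN : ∀ i, #(N i) + #(L i) = m.choose k := by
    intro i
    have hinj : Function.Injective (fun A : Finset {x // x ∈ S} => insert (i : ℕ) (A.map ι)) := by
      intro A B hAB
      have := congrArg (fun C => C.erase (i : ℕ)) hAB
      simp only [erase_insert (hhead _ _)] at this
      exact map_injective ι this
    rw [card_image_of_injective _ hinj, card_sdiff_add_card_eq_card (filter_subset _ _),
      card_powersetCard, card_univ, Fintype.card_coe, hScard]
  have hNdisj : Set.PairwiseDisjoint (univ : Finset (Fin (s + 1))) N := by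
    intro i _ j _ hij
    simp only [Function.onFun, disjoint_left, N, mem_image]
    rintro _ ⟨A, -, rfl⟩ ⟨B, -, hAB⟩
    have : (i : ℕ) ∈ insert (j : ℕ) (B.map ι) := by rw [hAB]; exact mem_insert_self _ _
    rcases mem_insert.1 this with h | h
    · exact hij (Fin.ext h)
    · exact hhead B i h
  have hN0disj : Disjoint (powersetCard (k + 1) S \ G) (univ.biUnion N) := by
    simp only [disjoint_left, mem_biUnion, mem_univ, true_and, N, mem_image, not_exists, not_and]
    rintro _ hA i B - rfl
    have := mem_Ico.1
      ((mem_powersetCard.1 (mem_sdiff.1 hA).1).1 (mem_insert_self (i : ℕ) (B.map ι)))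
    omega
  have hsub : (powersetCard (k + 1) S \ G) ∪ univ.biUnion N ⊆
      powersetCard (k + 1) (range (m + s + 1)) \ G := by
    refine union_subset (sdiff_subset_sdiff (powersetCard_mono ?_) subset_rfl) ?_
    · intro x hx
      exact mem_range.2 (mem_Ico.1 hx).2
    · intro C hC
      simp only [mem_biUnion, mem_univ, true_and, N, mem_image, mem_sdiff, hLmem,
        mem_powersetCard_univ] at hC
      obtain ⟨i, A, ⟨hA, hAL⟩, rfl⟩ := hC
      refine mem_sdiff.2 ⟨mem_powersetCard.2 ⟨insert_subset (mem_range.2 (by omega)) ?_, ?_⟩,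
        fun h => hAL ⟨hA, h⟩⟩
      · intro x hx
        exact mem_range.2 (hι A x hx).2
      · rw [card_insert_of_notMem (hhead A i), card_map, hA]
  have hcount := card_le_card hsub
  rw [card_union_of_disjoint hN0disj, card_biUnion hNdisj] at hcount
  have hcompl := card_sdiff_add_card_eq_card hG
  have hN0 := card_sdiff_add_card_inter (powersetCard (k + 1) S) G
  have hNsum : ∑ i, #(N i) + ∑ i, #(L i) = (s + 1) * m.choose k := by
    rw [← sum_add_distrib, sum_congr rfl fun i _ => hN i]
    simp
  rw [card_powersetCard, card_range] at hcompl
  rw [card_powersetCard, hScard] at hN0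
  have hmul := Nat.mul_le_mul_left s hshadow
  rw [Nat.choose_succ_succ' m k]
  rw [Nat.succ_mul] at hNsum
  omega

/-- Theorem of Frankl: if `n ≥ (2t-1)k - (t-1)` and the `k`-graph `H` on `[n]` has no
matching of size `t`, then `e(H) ≤ C(n,k) - C(n-t+1,k)`. -/
theorem stmt_16 (n k t : ℕ) (hn : 0 < n) (hk : 0 < k) (ht : 0 < t)
    (hnkt : (2 * t - 1) * k - (t - 1) ≤ n)
    (E : Finset (Finset (Fin n))) (hE : ∀ e ∈ E, e.card = k)
    (hν : ¬ ∃ M ⊆ E, M.card = t ∧ ∀ e ∈ M, ∀ f ∈ M, e ≠ f → Disjoint e f) :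
    E.card ≤ Nat.choose n k - Nat.choose (n - t + 1) k := by
  obtain ⟨k, rfl⟩ := Nat.exists_eq_add_of_lt hk
  obtain ⟨s, rfl⟩ := Nat.exists_eq_add_of_lt ht
  simp only [zero_add] at *
  have hexpand : (2 * (s + 1) - 1) * (k + 1) = (2 * s + 1) * k + (2 * s + 1) := by
    rw [show 2 * (s + 1) - 1 = 2 * s + 1 by omega]
    ring
  obtain ⟨m, rfl⟩ : ∃ m, n = m + s + 1 := ⟨n - (s + 1), by omega⟩
  let F : Finset (Finset ℕ) := E.map (mapEmbedding Fin.valEmbedding).toEmbedding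
  have hF : F ⊆ powersetCard (k + 1) (range (m + s + 1)) := by
    intro A hA
    obtain ⟨e, he, rfl⟩ := mem_map.1 hA
    refine mem_powersetCard.2 ⟨fun x hx => ?_, ?_⟩
    · obtain ⟨y, -, rfl⟩ := mem_map.1 hx
      exact mem_range.2 y.2
    · exact (card_map _).trans (hE e he)
  have hfree : MatchingFree F (s + 1) := by
    intro f hf hd
    choose g hgE hg using fun i => mem_map.1 (hf i)
    have hgd : ∀ i j, i ≠ j → Disjoint (g i) (g j) := by
      intro i j hij
      have := hd hij
      simp only [Function.onFun] at this
      rw [← hg i, ← hg j] at this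
      exact (disjoint_map Fin.valEmbedding).1 this
    have hginj : Function.Injective g := by
      intro i j hij
      by_contra hne
      have := hgd i j hne
      rw [hij, disjoint_self_iff_empty] at this
      have hc := hE _ (hgE j)
      rw [this, card_empty] at hc
      omega
    refine hν ⟨univ.image g, ?_, ?_, ?_⟩
    · intro e he
      obtain ⟨i, -, rfl⟩ := mem_image.1 he
      exact hgE i
    · rw [card_image_of_injective _ hginj, card_univ, Fintype.card_fin]
    · intro e he f hf hef
      obtain ⟨i, -, rfl⟩ := mem_image.1 he
      obtain ⟨j, -, rfl⟩ := mem_image.1 hf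
      exact hgd i j fun h => hef (h ▸ rfl)
  obtain ⟨G, hG, hGcard, hGfree, hGs⟩ := exists_isShifted F hF hfree
  have hmain := hGs.card_add_choose_le hG hGfree (by omega)
  rw [hGcard, show #F = #E from card_map _] at hmain
  rw [show m + s + 1 - (s + 1) + 1 = m + 1 by omega]
  omega
end

section
/- For every integer k ≥ 2 and reals r ≥ 1 and a > 0, there exist γ = γ(k,r,a) > 0 and d₀ = d₀(k,r,a) such that for every n and every D ≥ d₀ the following holds: every k-uniform hypergraph H = (V,E) on n vertices in which all vertices have positive degree and which satisfies (1) for all vertices x ∈ V with at most γn exceptions, |d_H(x) − D| ≤ γD; (2) d_H(x) < rD for all x ∈ V; and (3) d_H({x,y}) < γD for any two distinct x, y ∈ V, contains an edge cover of at most (1+a)(n/k) edges. -/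
namespace Nibble

open Finset Filter Topology

/-- The edges of `E` through `x`. -/
abbrev star {α : Type*} [DecidableEq α] (E : Finset (Finset α)) (x : α) : Finset (Finset α) :=
  E.filter fun e => x ∈ e

/-- The edges of `E` meeting `S`. -/
abbrev hit {α : Type*} [DecidableEq α] (E : Finset (Finset α)) (S : Finset α) :
    Finset (Finset α) :=
  E.filter fun e => ¬ Disjoint S e

/-- A `k`-uniform hypergraph with vertex set `V` and edge set `E` whose degrees are at most `r * D`
and, up to a proportion `γ` of the vertices, in `[(1 - γ) D, (1 + γ) D]`, and whose codegrees are at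
most `γ * D`. -/
structure NearRegular {α : Type*} [DecidableEq α] (k : ℕ) (r γ D : ℝ) (V : Finset α)
    (E : Finset (Finset α)) : Prop where
  pos : 0 < D
  subset : ∀ e ∈ E, e ⊆ V
  card_edge : ∀ e ∈ E, #e = k
  card_bad : (#(V.filter fun x => ¬ |(#(star E x) : ℝ) - D| ≤ γ * D) : ℝ) ≤ γ * #V
  degree_le : ∀ x, (#(star E x) : ℝ) ≤ r * D
  codegree_le : ∀ x y, x ≠ y → (#(E.filter fun e => x ∈ e ∧ y ∈ e) : ℝ) ≤ γ * D

/-- The vertices of near-average degree. -/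
noncomputable abbrev typical {α : Type*} [DecidableEq α] (γ D : ℝ) (V : Finset α)
    (E : Finset (Finset α)) : Finset α :=
  V.filter fun x => |(#(star E x) : ℝ) - D| ≤ γ * D

section Counting

variable {α : Type*} [DecidableEq α] {k : ℕ} {r γ D : ℝ} {V : Finset α} {E : Finset (Finset α)}

lemma NearRegular.sum_degree (h : NearRegular k r γ D V E) (F : Finset (Finset α)) (hF : F ⊆ E) :
    ∑ x ∈ V, (#(star F x) : ℝ) = k * #F := by
  have := Finset.sum_card_bipartiteAbove_eq_sum_card_bipartiteBelow
    (s := V) (t := F) (fun x e => x ∈ e)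
  have h2 : ∑ e ∈ F, #(bipartiteBelow (fun x e => x ∈ e) V e) = ∑ e ∈ F, k := by
    refine Finset.sum_congr rfl fun e he => ?_
    rw [← h.card_edge e (hF he)]
    congr 1
    ext x
    simp only [bipartiteBelow, mem_filter]
    exact ⟨fun h => h.2, fun hx => ⟨h.subset e (hF he) hx, hx⟩⟩
  rw [h2] at this
  simp only [sum_const, smul_eq_mul, bipartiteAbove] at this
  rw [mul_comm] at this
  exact_mod_cast this

lemma NearRegular.card_typical (h : NearRegular k r γ D V E) :
    (1 - γ) * #V ≤ #(typical γ D V E) := by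
  have h1 := Finset.card_filter_add_card_filter_not (s := V)
    (fun x => |(#(star E x) : ℝ) - D| ≤ γ * D)
  have h2 : (#(typical γ D V E) : ℝ) +
      #(V.filter fun x => ¬ |(#(star E x) : ℝ) - D| ≤ γ * D) = #V := by
    exact_mod_cast h1
  linarith [h.card_bad]

/-- A sum over vertices, bounded separately at typical and at exceptional vertices. -/
lemma NearRegular.sum_le (h : NearRegular k r γ D V E) (f : α → ℝ) (A B : ℝ) (hA : 0 ≤ A)
    (hB : 0 ≤ B)
    (hfA : ∀ x ∈ typical γ D V E, f x ≤ A) (hfB : ∀ x ∈ V, f x ≤ B) :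
    ∑ x ∈ V, f x ≤ #V * (A + γ * B) := by
  rw [← Finset.sum_filter_add_sum_filter_not V (fun x => |(#(star E x) : ℝ) - D| ≤ γ * D)]
  have h1 := Finset.sum_le_card_nsmul _ _ _ hfA
  have h2 := Finset.sum_le_card_nsmul (V.filter fun x => ¬ |(#(star E x) : ℝ) - D| ≤ γ * D) f B
    fun x hx => hfB x (mem_of_mem_filter x hx)
  have h3 : (#(typical γ D V E) : ℝ) ≤ #V := by exact_mod_cast card_filter_le _ _
  simp only [nsmul_eq_mul] at h1 h2
  nlinarith [h.card_bad, mul_le_mul_of_nonneg_right h3 hA,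
    mul_le_mul_of_nonneg_right h.card_bad hB]

lemma NearRegular.card_edges_le (h : NearRegular k r γ D V E) (hr : 0 ≤ r) (hγ : 0 ≤ γ) :
    k * (#E : ℝ) ≤ #V * D * (1 + γ + γ * r) := by
  rw [← h.sum_degree E subset_rfl]
  have hD := h.pos
  refine (h.sum_le _ ((1 + γ) * D) (r * D) (by positivity) (by positivity) ?_
    fun x _ => h.degree_le x).trans (le_of_eq (by ring))
  intro x hx
  have := (abs_le.1 (mem_filter.1 hx).2).2
  linarith

lemma NearRegular.le_card_edges (h : NearRegular k r γ D V E) (hγ : γ ≤ 1) :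
    #V * D * (1 - γ) ^ 2 ≤ k * (#E : ℝ) := by
  rw [← h.sum_degree E subset_rfl]
  have hD := h.pos
  calc (#V * D * (1 - γ) ^ 2 : ℝ) = ((1 - γ) * #V) * ((1 - γ) * D) := by ring
    _ ≤ #(typical γ D V E) * ((1 - γ) * D) := by
        have : 0 ≤ (1 - γ) * D := mul_nonneg (by linarith) hD.le
        exact mul_le_mul_of_nonneg_right h.card_typical this
    _ ≤ ∑ x ∈ typical γ D V E, (#(star E x) : ℝ) := by
        rw [← nsmul_eq_mul]
        refine Finset.card_nsmul_le_sum _ _ _ fun x hx => ?_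
        have := (abs_le.1 (mem_filter.1 hx).2).1
        linarith
    _ ≤ _ := Finset.sum_le_sum_of_subset_of_nonneg (filter_subset _ _) fun _ _ _ => by positivity

/-- Few edges through `x` meet a small set avoiding `x`. -/
lemma NearRegular.card_star_hit_le (h : NearRegular k r γ D V E) (x : α) (S : Finset α)
    (hx : x ∉ S) : (#((star E x).filter fun e => ¬ Disjoint S e) : ℝ) ≤ #S * (γ * D) := by
  have : (star E x).filter (fun e => ¬ Disjoint S e) ⊆
      S.biUnion fun y => E.filter fun e => x ∈ e ∧ y ∈ e := by
    intro e he
    simp only [mem_filter, Finset.not_disjoint_iff] at he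
    obtain ⟨⟨he, hxe⟩, y, hy, hye⟩ := he
    exact mem_biUnion.2 ⟨y, hy, mem_filter.2 ⟨he, hxe, hye⟩⟩
  calc (#((star E x).filter fun e => ¬ Disjoint S e) : ℝ)
      ≤ ((∑ y ∈ S, #(E.filter fun e => x ∈ e ∧ y ∈ e) : ℕ) : ℝ) := by
        exact_mod_cast (card_le_card this).trans card_biUnion_le
    _ ≤ ∑ y ∈ S, γ * D := by
        push_cast
        exact Finset.sum_le_sum fun y hy => h.codegree_le x y (by rintro rfl; exact hx hy)
    _ = _ := by simp

lemma NearRegular.le_card_mul (h : NearRegular k r γ D V E) (hk : 2 ≤ k) (hγ₀ : 0 ≤ γ) (hγ : γ < 1)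
    (hV : V.Nonempty) : 1 - γ ≤ #V * γ := by
  have hD := h.pos
  have hpos : (0 : ℝ) < #(typical γ D V E) := by
    refine lt_of_lt_of_le ?_ h.card_typical
    have : (0 : ℝ) < #V := by exact_mod_cast hV.card_pos
    exact mul_pos (by linarith) this
  obtain ⟨x, hx⟩ := card_pos.1 (Nat.cast_pos.1 hpos)
  have h1 := (abs_le.1 (mem_filter.1 hx).2).1
  have h2 := h.card_star_hit_le x (V.erase x) (by simp)
  have h3 : (star E x).filter (fun e => ¬ Disjoint (V.erase x) e) = star E x := by
    refine filter_true_of_mem fun e he => ?_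
    have he' := mem_filter.1 he
    obtain ⟨y, hy, hyx⟩ := Finset.exists_mem_ne (s := e) (by rw [h.card_edge e he'.1]; omega) x
    exact Finset.not_disjoint_iff.2 ⟨y, mem_erase.2 ⟨hyx, h.subset e he'.1 hy⟩, hy⟩
  rw [h3] at h2
  have h4 : (#(V.erase x) : ℝ) ≤ #V := by exact_mod_cast card_le_card (erase_subset _ _)
  have h5 : (1 - γ) * D ≤ (#V * γ) * D := by
    nlinarith [mul_le_mul_of_nonneg_right h4 (mul_nonneg hγ₀ hD.le)]
  exact le_of_mul_le_mul_right h5 hD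

lemma NearRegular.hit_bounds (h : NearRegular k r γ D V E) (S : Finset α)
    (hS : S ⊆ typical γ D V E) :
    #S * D * (1 - γ - #S * γ) ≤ (#(hit E S) : ℝ) ∧ (#(hit E S) : ℝ) ≤ #S * D * (1 + γ) := by
  have hD := h.pos
  induction S using Finset.induction_on with
  | empty => simp
  | insert x S hx ih =>
    obtain ⟨ih1, ih2⟩ := ih ((subset_insert _ _).trans hS)
    have hxt := (mem_filter.1 (hS (mem_insert_self x S))).2
    have h1 := abs_le.1 hxt
    have h2 := h.card_star_hit_le x S hx
    have heq : hit E (insert x S) = star E x ∪ hit E S := by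
      ext e
      simp only [mem_filter, mem_union, Finset.disjoint_insert_left]
      tauto
    have hint : star E x ∩ hit E S = (star E x).filter fun e => ¬ Disjoint S e := by
      ext e
      simp only [mem_filter, mem_inter]
      tauto
    have hc := card_union_add_card_inter (star E x) (hit E S)
    rw [hint, ← heq] at hc
    have hc' : (#(hit E (insert x S)) : ℝ) + #((star E x).filter fun e => ¬ Disjoint S e)
        = #(star E x) + #(hit E S) := by exact_mod_cast hc
    rw [card_insert_of_notMem hx]
    push_cast
    have : (0 : ℝ) ≤ #((star E x).filter fun e => ¬ Disjoint S e) := by positivity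
    constructor
    · nlinarith [abs_nonneg ((#(star E x) : ℝ) - D)]
    · nlinarith

end Counting

/-- Uniform Poisson approximation `(1 - N / M) ^ m ≈ exp (-j ε)`, when `N ≈ j D`, `M ≈ n D / k`
and `m ≈ ε n / k`, with errors controlled by `γ`. -/
lemma eventually_abs_pow_sub_exp_le (k : ℕ) (hk : 0 < k) (r ε δ : ℝ) (hr : 0 ≤ r) (hε : 0 < ε)
    (hδ : 0 < δ) (j : ℕ) :
    ∀ᶠ γ : ℝ in 𝓝[>] 0, ∀ (n m : ℕ) (D M N : ℝ), 0 < D → 0 < n → 1 - γ ≤ n * γ →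
      k * M ≤ n * D * (1 + γ + γ * r) → n * D * (1 - γ) ^ 2 ≤ k * M →
      j * D * (1 - γ - j * γ) ≤ N → N ≤ j * D * (1 + γ) → 0 ≤ N →
      (m : ℝ) ≤ ε * n / k → ε * n / k - 1 ≤ m →
      |(1 - N / M) ^ m - Real.exp (-(j * ε))| ≤ δ := by
  have hk' : (0 : ℝ) < k := by exact_mod_cast hk
  let u : ℝ → ℝ := fun γ => j * k * γ * (1 + γ) / (1 - γ) ^ 3
  let hi : ℝ → ℝ := fun γ => j * ε * (1 + γ) / (1 - γ) ^ 2 / (1 - u γ)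
  let lo : ℝ → ℝ := fun γ => j * (1 - γ - j * γ) / (1 + γ + γ * r) * (ε - k * γ / (1 - γ))
  have cu : ContinuousAt u 0 := by
    apply ContinuousAt.div <;> first | fun_prop | norm_num
  have chi : ContinuousAt hi 0 := by
    apply ContinuousAt.div
    · apply ContinuousAt.div <;> first | fun_prop | norm_num
    · fun_prop
    · simp [u]
  have clo : ContinuousAt lo 0 := by
    apply ContinuousAt.mul
    · apply ContinuousAt.div <;> first | fun_prop | norm_num
    · apply ContinuousAt.sub continuousAt_const
      apply ContinuousAt.div <;> first | fun_prop | norm_num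
  have t1 : Tendsto (fun γ => Real.exp (-hi γ)) (𝓝[>] 0) (𝓝 (Real.exp (-(j * ε)))) := by
    have : Tendsto (fun γ => Real.exp (-hi γ)) (𝓝 0) (𝓝 (Real.exp (-hi 0))) :=
      (Real.continuous_exp.continuousAt.comp chi.neg).tendsto
    simpa [hi, u] using this.mono_left nhdsWithin_le_nhds
  have t2 : Tendsto (fun γ => Real.exp (-lo γ)) (𝓝[>] 0) (𝓝 (Real.exp (-(j * ε)))) := by
    have : Tendsto (fun γ => Real.exp (-lo γ)) (𝓝 0) (𝓝 (Real.exp (-lo 0))) :=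
      (Real.continuous_exp.continuousAt.comp clo.neg).tendsto
    simpa [lo] using this.mono_left nhdsWithin_le_nhds
  have e1 := t1.eventually (lt_mem_nhds (show Real.exp (-(j * ε)) - δ < _ by linarith))
  have e2 := t2.eventually (gt_mem_nhds (show _ < Real.exp (-(j * ε)) + δ by linarith))
  have e3 : ∀ᶠ γ : ℝ in 𝓝[>] 0, u γ < 1 :=
    (cu.tendsto.mono_left nhdsWithin_le_nhds).eventually (gt_mem_nhds (by simp [u]))
  have e4 : ∀ᶠ γ : ℝ in 𝓝[>] 0, 0 < 1 - γ - j * γ := by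
    have : ContinuousAt (fun γ : ℝ => 1 - γ - j * γ) 0 := by fun_prop
    exact (this.tendsto.mono_left nhdsWithin_le_nhds).eventually (lt_mem_nhds (by simp))
  have e5 : ∀ᶠ γ : ℝ in 𝓝[>] 0, 0 < ε - k * γ / (1 - γ) := by
    have : ContinuousAt (fun γ : ℝ => ε - k * γ / (1 - γ)) 0 := by
      apply ContinuousAt.sub continuousAt_const
      apply ContinuousAt.div <;> first | fun_prop | norm_num
    exact (this.tendsto.mono_left nhdsWithin_le_nhds).eventually (lt_mem_nhds (by simpa))
  filter_upwards [e1, e2, e3, e4, e5, self_mem_nhdsWithin] with γ e1 e2 e3 e4 e5 hγ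
  intro n m D M N hD hn hnγ hM1 hM2 hN1 hN2 hN0 hm1 hm2
  have hγ : 0 < γ := hγ
  have hn' : (0 : ℝ) < n := by exact_mod_cast hn
  have hγ1 : 0 < 1 - γ := by
    have : 0 ≤ (j : ℝ) * γ := by positivity
    linarith
  have hM : 0 < M := by
    have : 0 < k * M := lt_of_lt_of_le (by positivity) hM2
    exact pos_of_mul_pos_right this hk'.le
  have hinv : 1 / (n : ℝ) ≤ γ / (1 - γ) := by
    rw [div_le_div_iff₀ hn' hγ1]; linarith
  have hx : N / M ≤ j * k * (1 + γ) / (1 - γ) ^ 2 * (1 / n) := by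
    calc N / M ≤ j * D * (1 + γ) / (n * D * (1 - γ) ^ 2 / k) := by
          apply div_le_div₀ (by positivity) hN2 (by positivity)
          rw [div_le_iff₀ hk']; linarith
      _ = _ := by field_simp
  have hxu : N / M ≤ u γ := by
    refine hx.trans ((mul_le_mul_of_nonneg_left hinv (by positivity)).trans (le_of_eq ?_))
    simp only [u]; field_simp
  have hx0 : 0 ≤ N / M := by positivity
  have hhi : N / M * m ≤ j * ε * (1 + γ) / (1 - γ) ^ 2 := by
    calc N / M * m ≤ j * k * (1 + γ) / (1 - γ) ^ 2 * (1 / n) * (ε * n / k) :=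
          mul_le_mul hx hm1 (by positivity) (by positivity)
      _ = _ := by field_simp
  have hlo : lo γ ≤ N / M * m := by
    calc lo γ ≤ j * (1 - γ - j * γ) / (1 + γ + γ * r) * (ε - k * (1 / n)) := by
          simp only [lo]
          gcongr
          rw [mul_div_assoc]
          gcongr
      _ = (j * D * (1 - γ - j * γ)) / (n * D * (1 + γ + γ * r) / k) * (ε * n / k - 1) := by
          field_simp
      _ ≤ N / M * (ε * n / k - 1) := by
          apply mul_le_mul_of_nonneg_right
          · apply div_le_div₀ hN0 hN1 hM
            rw [le_div_iff₀ hk']; linarith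
          · have : k * (1 / n) ≤ k * (γ / (1 - γ)) := mul_le_mul_of_nonneg_left hinv hk'.le
            rw [← mul_div_assoc (k : ℝ) γ] at this
            have h1 : 0 ≤ (ε - k * (1 / n)) * (n / k) :=
              mul_nonneg (by linarith) (by positivity)
            refine h1.trans (le_of_eq ?_)
            field_simp
      _ ≤ N / M * m := mul_le_mul_of_nonneg_left hm2 hx0
  have hx1 : 0 < 1 - N / M := by linarith
  rw [abs_le]
  constructor
  · have h1 : Real.exp (-(N / M / (1 - N / M))) ≤ 1 - N / M := by
      rw [Real.exp_neg, inv_le_comm₀ (Real.exp_pos _) hx1]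
      refine le_trans (le_of_eq ?_) (Real.add_one_le_exp _)
      rw [div_add_one hx1.ne', add_sub_cancel, one_div]
    have h2 : Real.exp (-(N / M / (1 - N / M))) ^ m ≤ (1 - N / M) ^ m :=
      pow_le_pow_left₀ (Real.exp_pos _).le h1 m
    rw [← Real.exp_nat_mul] at h2
    have h3 : Real.exp (-hi γ) ≤ Real.exp (m * -(N / M / (1 - N / M))) := by
      apply Real.exp_le_exp.2
      have : N / M * m / (1 - N / M) ≤ hi γ := by
        simp only [hi]
        apply div_le_div₀ (by positivity) hhi (by linarith) (by linarith)
      calc -hi γ ≤ -(N / M * m / (1 - N / M)) := neg_le_neg this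
        _ = _ := by ring
    linarith
  · have h1 : 1 - N / M ≤ Real.exp (-(N / M)) := Real.one_sub_le_exp_neg _
    have h2 : (1 - N / M) ^ m ≤ Real.exp (-(N / M)) ^ m := pow_le_pow_left₀ hx1.le h1 m
    rw [← Real.exp_nat_mul] at h2
    have h3 : Real.exp (m * -(N / M)) ≤ Real.exp (-lo γ) := by
      apply Real.exp_le_exp.2
      linarith
    linarith

section Sampling

variable {α : Type*} [DecidableEq α] {k : ℕ} {r γ D : ℝ} {V : Finset α} {E : Finset (Finset α)}

/-- The probability that `m` independent uniformly random edges of `E` all avoid `S`. -/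
noncomputable def avoidProb (E : Finset (Finset α)) (m : ℕ) (S : Finset α) : ℝ :=
  (1 - (#(hit E S) : ℝ) / #E) ^ m

lemma avoidProb_base_mem (E : Finset (Finset α)) (S : Finset α) :
    0 ≤ 1 - (#(hit E S) : ℝ) / #E ∧ 1 - (#(hit E S) : ℝ) / #E ≤ 1 := by
  have h1 : (#(hit E S) : ℝ) ≤ #E := by exact_mod_cast card_filter_le _ _
  have h2 : (#(hit E S) : ℝ) / #E ≤ 1 := div_le_one_of_le₀ h1 (by positivity)
  have h3 : 0 ≤ (#(hit E S) : ℝ) / #E := by positivity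
  constructor <;> linarith

lemma avoidProb_nonneg (E : Finset (Finset α)) (m : ℕ) (S : Finset α) : 0 ≤ avoidProb E m S :=
  pow_nonneg (avoidProb_base_mem E S).1 m

lemma avoidProb_le_one (E : Finset (Finset α)) (m : ℕ) (S : Finset α) : avoidProb E m S ≤ 1 :=
  pow_le_one₀ (avoidProb_base_mem E S).1 (avoidProb_base_mem E S).2

/-- The sequences of `m` edges. -/
abbrev samples (E : Finset (Finset α)) (m : ℕ) : Finset (Fin m → Finset α) :=
  Fintype.piFinset fun _ => E

/-- The indicator that all edges of the sequence `ω` avoid `S`. -/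
def avoids {m : ℕ} (S : Finset α) (ω : Fin m → Finset α) : ℝ :=
  if ∀ i, Disjoint S (ω i) then 1 else 0

lemma avoids_mul {m : ℕ} (S T : Finset α) (ω : Fin m → Finset α) :
    avoids S ω * avoids T ω = avoids (S ∪ T) ω := by
  simp only [avoids, Finset.disjoint_union_left, forall_and]
  split_ifs <;> simp_all

lemma sum_avoids (hE : E.Nonempty) (m : ℕ) (S : Finset α) :
    ∑ ω ∈ samples E m, avoids S ω = #(samples E m) * avoidProb E m S := by
  have h1 : (samples E m).filter (fun ω => ∀ i, Disjoint S (ω i))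
      = Fintype.piFinset fun _ => E.filter fun e => Disjoint S e := by
    ext ω
    simp [Fintype.mem_piFinset, forall_and]
  have hE' : (#E : ℝ) ≠ 0 := by exact_mod_cast hE.card_pos.ne'
  have h2 := Finset.card_filter_add_card_filter_not (s := E) (fun e => Disjoint S e)
  have h3 : (#(E.filter fun e => Disjoint S e) : ℝ) = #E * (1 - (#(hit E S) : ℝ) / #E) := by
    have : (#(E.filter fun e => Disjoint S e) : ℝ) + #(hit E S) = #E := by exact_mod_cast h2
    field_simp
    linarith
  simp only [avoids, Finset.sum_boole]
  rw [h1, Fintype.card_piFinset_const, Fintype.card_piFinset_const]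
  push_cast
  rw [h3, mul_pow, avoidProb]

/-- The number of edges through `x` all of whose other vertices are avoided by `ω`. -/
def avoidDegree {m : ℕ} (E : Finset (Finset α)) (x : α) (ω : Fin m → Finset α) : ℝ :=
  ∑ e ∈ star E x, avoids (e.erase x) ω

lemma sum_avoidDegree_sub_sq (hE : E.Nonempty) (m : ℕ) (x : α) (c : ℝ) :
    ∑ ω ∈ samples E m, (avoidDegree E x ω - c) ^ 2 = #(samples E m) *
      (∑ e ∈ star E x, ∑ f ∈ star E x, avoidProb E m (e.erase x ∪ f.erase x)
        - 2 * c * ∑ e ∈ star E x, avoidProb E m (e.erase x) + c ^ 2) := by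
  have h1 : ∀ ω : Fin m → Finset α, (avoidDegree E x ω - c) ^ 2 =
      ∑ e ∈ star E x, ∑ f ∈ star E x, avoids (e.erase x ∪ f.erase x) ω
        - 2 * c * ∑ e ∈ star E x, avoids (e.erase x) ω + c ^ 2 := by
    intro ω
    simp only [← avoids_mul, ← Finset.sum_mul_sum]
    simp only [avoidDegree]
    ring
  simp only [h1, Finset.sum_add_distrib, Finset.sum_sub_distrib, ← Finset.mul_sum]
  have h2 : ∑ ω ∈ samples E m, ∑ e ∈ star E x, ∑ f ∈ star E x, avoids (e.erase x ∪ f.erase x) ω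
      = #(samples E m) *
        ∑ e ∈ star E x, ∑ f ∈ star E x, avoidProb E m (e.erase x ∪ f.erase x) := by
    rw [Finset.sum_comm, Finset.mul_sum]
    refine Finset.sum_congr rfl fun e _ => ?_
    rw [Finset.sum_comm, Finset.mul_sum]
    exact Finset.sum_congr rfl fun f _ => sum_avoids hE m _
  have h3 : ∑ ω ∈ samples E m, ∑ e ∈ star E x, avoids (e.erase x) ω
      = #(samples E m) * ∑ e ∈ star E x, avoidProb E m (e.erase x) := by
    rw [Finset.sum_comm, Finset.mul_sum]
    exact Finset.sum_congr rfl fun f _ => sum_avoids hE m _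
  rw [h2, h3]
  simp only [sum_const, nsmul_eq_mul]
  ring

/-- The edges containing an exceptional vertex. -/
noncomputable abbrev atypicalEdges (γ D : ℝ) (V : Finset α) (E : Finset (Finset α)) :
    Finset (Finset α) :=
  E.filter fun e => ¬ e ⊆ typical γ D V E

lemma card_star_atypicalEdges (γ D : ℝ) (V : Finset α) (E : Finset (Finset α)) (x : α) :
    (#(star (atypicalEdges γ D V E) x) : ℝ)
      = ∑ e ∈ star E x, if ¬ e ⊆ typical γ D V E then (1 : ℝ) else 0 := by
  rw [Finset.sum_boole, star, atypicalEdges, filter_filter, filter_filter]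
  congr 2
  ext e
  simp only [mem_filter]
  tauto

lemma NearRegular.sum_atypical_le (h : NearRegular k r γ D V E) (hr : 0 ≤ r) :
    ∑ x ∈ V, (#(star (atypicalEdges γ D V E) x) : ℝ) ≤ #V * D * (k * r * γ) := by
  have hD := h.pos
  rw [h.sum_degree _ (filter_subset _ _)]
  have hsub : atypicalEdges γ D V E ⊆
      (V.filter fun x => ¬ |(#(star E x) : ℝ) - D| ≤ γ * D).biUnion fun x => star E x := by
    intro e he
    obtain ⟨he, hne⟩ := mem_filter.1 he
    obtain ⟨x, hx, hxt⟩ := Finset.not_subset.1 hne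
    have hxV := h.subset e he hx
    refine mem_biUnion.2 ⟨x, mem_filter.2 ⟨hxV, fun hh => hxt (mem_filter.2 ⟨hxV, hh⟩)⟩,
      mem_filter.2 ⟨he, hx⟩⟩
  have h1 : (#(atypicalEdges γ D V E) : ℝ) ≤
      ∑ x ∈ V.filter (fun x => ¬ |(#(star E x) : ℝ) - D| ≤ γ * D), (#(star E x) : ℝ) := by
    exact_mod_cast (card_le_card hsub).trans card_biUnion_le
  have h2 := Finset.sum_le_card_nsmul (V.filter fun x => ¬ |(#(star E x) : ℝ) - D| ≤ γ * D)
    (fun x => (#(star E x) : ℝ)) (r * D) fun x _ => h.degree_le x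
  rw [nsmul_eq_mul] at h2
  have h3 := mul_le_mul_of_nonneg_right h.card_bad (mul_nonneg hr hD.le)
  calc (k : ℝ) * #(atypicalEdges γ D V E) ≤ k * (γ * #V * (r * D)) :=
        mul_le_mul_of_nonneg_left (h1.trans (h2.trans h3)) (by positivity)
    _ = _ := by ring

lemma NearRegular.sum_pair_avoidProb_le (h : NearRegular k r γ D V E) {m : ℕ} {q δ : ℝ} (hδ : 0 ≤ δ)
    (hp : ∀ S ⊆ typical γ D V E, #S = 2 * (k - 1) → |avoidProb E m S - q ^ 2| ≤ δ) (x : α) :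
    ∑ e ∈ star E x, ∑ f ∈ star E x, avoidProb E m (e.erase x ∪ f.erase x) ≤
      (#(star E x) : ℝ) ^ 2 * (q ^ 2 + δ) + 2 * #(star (atypicalEdges γ D V E) x) * #(star E x)
        + #(star E x) * ((k - 1 : ℕ) * (γ * D)) := by
  have hcast := card_star_atypicalEdges γ D V E x
  set T := typical γ D V E
  have hpt : ∀ e ∈ star E x, ∀ f ∈ star E x, avoidProb E m (e.erase x ∪ f.erase x) ≤
      (q ^ 2 + δ) + (if ¬ e ⊆ T then (1 : ℝ) else 0) + (if ¬ f ⊆ T then (1 : ℝ) else 0)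
        + (if ¬ Disjoint (e.erase x) f then (1 : ℝ) else 0) := by
    intro e he f hf
    have hle := avoidProb_le_one E m (e.erase x ∪ f.erase x)
    have hq := sq_nonneg q
    obtain ⟨heE, hxe⟩ := mem_filter.1 he
    obtain ⟨hfE, hxf⟩ := mem_filter.1 hf
    by_cases h1 : e ⊆ T
    · by_cases h2 : f ⊆ T
      · by_cases h3 : Disjoint (e.erase x) f
        · have hc : #(e.erase x ∪ f.erase x) = 2 * (k - 1) := by
            rw [card_union_of_disjoint (h3.mono_right (erase_subset _ _)), card_erase_of_mem hxe,
              card_erase_of_mem hxf, h.card_edge e heE, h.card_edge f hfE]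
            ring
          have := (abs_le.1 (hp _ (union_subset ((erase_subset _ _).trans h1)
            ((erase_subset _ _).trans h2)) hc)).2
          simp only [h1, h2, h3, not_true, if_false]
          linarith
        · simp only [h1, h2, h3, not_true, if_false, not_false_eq_true, if_true]
          linarith
      · simp only [h1, h2, not_true, if_false, not_false_eq_true, if_true]
        split_ifs <;> linarith
    · simp only [h1, not_false_eq_true, if_true]
      split_ifs <;> linarith
  refine (Finset.sum_le_sum fun e he => Finset.sum_le_sum fun f hf => hpt e he f hf).trans ?_
  simp only [Finset.sum_add_distrib, sum_const, nsmul_eq_mul, ← hcast, ← Finset.mul_sum]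
  have hcod : ∑ e ∈ star E x, ∑ f ∈ star E x, (if ¬ Disjoint (e.erase x) f then (1 : ℝ) else 0)
      ≤ #(star E x) * ((k - 1 : ℕ) * (γ * D)) := by
    rw [← nsmul_eq_mul]
    refine Finset.sum_le_card_nsmul _ _ _ fun e he => ?_
    obtain ⟨heE, hxe⟩ := mem_filter.1 he
    rw [Finset.sum_boole]
    have := h.card_star_hit_le x (e.erase x) (by simp)
    rwa [card_erase_of_mem hxe, h.card_edge e heE] at this
  linarith

lemma NearRegular.le_sum_avoidProb (h : NearRegular k r γ D V E) {m : ℕ} {q δ : ℝ}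
    (hδ : 0 ≤ δ) (hq : q ≤ 1)
    (hp : ∀ S ⊆ typical γ D V E, #S = k - 1 → |avoidProb E m S - q| ≤ δ) (x : α) :
    #(star E x) * (q - δ) - #(star (atypicalEdges γ D V E) x) ≤
      ∑ e ∈ star E x, avoidProb E m (e.erase x) := by
  have hcast := card_star_atypicalEdges γ D V E x
  set T := typical γ D V E
  rw [hcast, ← nsmul_eq_mul, ← Finset.sum_const, ← Finset.sum_sub_distrib]
  refine Finset.sum_le_sum fun e he => ?_
  obtain ⟨heE, hxe⟩ := mem_filter.1 he
  have h0 := avoidProb_nonneg E m (e.erase x)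
  by_cases h1 : e ⊆ T
  · have := (abs_le.1 (hp _ ((erase_subset x _).trans h1)
      (by rw [card_erase_of_mem hxe, h.card_edge e heE]))).1
    simp only [h1, not_true, if_false]
    linarith
  · simp only [h1, not_false_eq_true, if_true]
    linarith

lemma NearRegular.second_moment_le (h : NearRegular k r γ D V E) {m : ℕ} {q δ : ℝ}
    (hr : 0 ≤ r) (hγ : 0 ≤ γ)
    (hδ : 0 ≤ δ) (hq₀ : 0 ≤ q) (hq : q ≤ 1)
    (hp₁ : ∀ S ⊆ typical γ D V E, #S = k - 1 → |avoidProb E m S - q| ≤ δ)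
    (hp₂ : ∀ S ⊆ typical γ D V E, #S = 2 * (k - 1) → |avoidProb E m S - q ^ 2| ≤ δ) (x : α) :
    ∑ e ∈ star E x, ∑ f ∈ star E x, avoidProb E m (e.erase x ∪ f.erase x)
        - 2 * (q * D) * ∑ e ∈ star E x, avoidProb E m (e.erase x) + (q * D) ^ 2 ≤
      ((#(star E x) : ℝ) - D) ^ 2 + D ^ 2 * (r ^ 2 * δ + r * k * γ + 2 * r * δ)
        + 2 * (r + 1) * D * #(star (atypicalEdges γ D V E) x) := by
  have hD := h.pos
  have h1 := h.sum_pair_avoidProb_le hδ hp₂ x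
  have h2 := h.le_sum_avoidProb hδ hq hp₁ x
  have hd := h.degree_le x
  set d : ℝ := ((#(star E x) : ℕ) : ℝ)
  set b : ℝ := ((#(star (atypicalEdges γ D V E) x) : ℕ) : ℝ)
  have hd0 : 0 ≤ d := Nat.cast_nonneg _
  have hb0 : 0 ≤ b := Nat.cast_nonneg _
  have h3 := mul_le_mul_of_nonneg_left h2 (show 0 ≤ 2 * (q * D) by positivity)
  have hk1 : ((k - 1 : ℕ) : ℝ) ≤ k := by exact_mod_cast Nat.sub_le k 1
  have e1 : d ^ 2 * δ ≤ (r * D) ^ 2 * δ := by gcongr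
  have e2 : 2 * b * d ≤ 2 * b * (r * D) := by gcongr
  have e3 : d * ((k - 1 : ℕ) * (γ * D)) ≤ (r * D) * (k * (γ * D)) := by gcongr
  have e4 : 2 * (q * D) * (d * δ) ≤ 2 * (1 * D) * (r * D * δ) := by gcongr
  have e5 : 2 * (q * D) * b ≤ 2 * (1 * D) * b := by gcongr
  have e6 : q ^ 2 * (d - D) ^ 2 ≤ 1 * (d - D) ^ 2 := by
    gcongr
    exact pow_le_one₀ hq₀ hq
  nlinarith

lemma NearRegular.sum_second_moment_le (h : NearRegular k r γ D V E) {m : ℕ} {q δ : ℝ}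
    (hE : E.Nonempty) (hr : 0 ≤ r) (hγ : 0 ≤ γ)
    (hδ : 0 ≤ δ) (hq₀ : 0 ≤ q) (hq : q ≤ 1)
    (hp₁ : ∀ S ⊆ typical γ D V E, #S = k - 1 → |avoidProb E m S - q| ≤ δ)
    (hp₂ : ∀ S ⊆ typical γ D V E, #S = 2 * (k - 1) → |avoidProb E m S - q ^ 2| ≤ δ) :
    ∑ ω ∈ samples E m, ∑ x ∈ V, (avoidDegree E x ω - q * D) ^ 2 ≤
      #(samples E m) * (#V * D ^ 2 * (γ ^ 2 + γ * (r + 1) ^ 2 + r ^ 2 * δ + r * k * γ + 2 * r * δ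
        + 2 * (r + 1) * k * r * γ)) := by
  have hD := h.pos
  rw [Finset.sum_comm]
  simp only [sum_avoidDegree_sub_sq hE]
  rw [← Finset.mul_sum]
  refine mul_le_mul_of_nonneg_left ?_ (by positivity)
  refine (Finset.sum_le_sum fun x _ =>
    h.second_moment_le hr hγ hδ hq₀ hq hp₁ hp₂ x).trans ?_
  have h1 : ∑ x ∈ V, ((#(star E x) : ℝ) - D) ^ 2 ≤
      #V * ((γ * D) ^ 2 + γ * ((r + 1) * D) ^ 2) := by
    refine h.sum_le _ _ _ (by positivity) (by positivity) (fun x hx => ?_) fun x _ => ?_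
    · exact sq_le_sq' (by linarith [(abs_le.1 (mem_filter.1 hx).2).1])
        (abs_le.1 (mem_filter.1 hx).2).2
    · have h0 : (0 : ℝ) ≤ #(star E x) := by positivity
      have := mul_nonneg hr hD.le
      exact sq_le_sq' (by linarith) (by linarith [h.degree_le x])
  have h2 := mul_le_mul_of_nonneg_left (h.sum_atypical_le hr)
    (show 0 ≤ 2 * (r + 1) * D by positivity)
  rw [Finset.sum_add_distrib, Finset.sum_add_distrib, sum_const, nsmul_eq_mul, ← Finset.mul_sum]
  linarith

lemma NearRegular.sum_survivors_le (h : NearRegular k r γ D V E) {m : ℕ} {p δ : ℝ}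
    (hE : E.Nonempty) (hδ : 0 ≤ δ) (hp : 0 ≤ p)
    (hp₁ : ∀ S ⊆ typical γ D V E, #S = 1 → |avoidProb E m S - p| ≤ δ) :
    ∑ ω ∈ samples E m, ∑ x ∈ V, avoids {x} ω ≤ #(samples E m) * (#V * (p + δ + γ)) := by
  rw [Finset.sum_comm]
  simp only [sum_avoids hE]
  rw [← Finset.mul_sum]
  refine mul_le_mul_of_nonneg_left ?_ (by positivity)
  have := h.sum_le (fun x => avoidProb E m {x}) (p + δ) 1 (by positivity) zero_le_one
    (fun x hx => by
      have := (abs_le.1 (hp₁ {x} (by simpa using hx) (by simp))).2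
      linarith) (fun x _ => avoidProb_le_one _ _ _)
  rwa [mul_one] at this

end Sampling

section Survivors

variable {α : Type*} [DecidableEq α] {k : ℕ} {r γ D : ℝ} {V : Finset α} {E : Finset (Finset α)}

/-- The vertices of `V` not covered by the edges of the sequence `ω`. -/
abbrev survivors {m : ℕ} (V : Finset α) (ω : Fin m → Finset α) : Finset α :=
  V \ (univ.image ω).biUnion id

lemma mem_survivors {m : ℕ} {ω : Fin m → Finset α} {x : α} :
    x ∈ survivors V ω ↔ x ∈ V ∧ ∀ i, x ∉ ω i := by
  simp [survivors]

lemma card_survivors {m : ℕ} (V : Finset α) (ω : Fin m → Finset α) :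
    (#(survivors V ω) : ℝ) = ∑ x ∈ V, avoids {x} ω := by
  simp only [avoids, Finset.sum_boole, Finset.disjoint_singleton_left]
  congr 2
  ext x
  rw [mem_survivors, mem_filter]

lemma NearRegular.card_survivors_ge (h : NearRegular k r γ D V E) {m : ℕ} {ω : Fin m → Finset α}
    (hω : ω ∈ samples E m) : (#V : ℝ) - m * k ≤ #(survivors V ω) := by
  have h1 : #((univ.image ω).biUnion id) ≤ m * k := by
    refine (card_biUnion_le_card_mul _ _ k fun e he => ?_).trans
      (Nat.mul_le_mul_right k (card_image_le.trans (by simp)))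
    obtain ⟨i, -, rfl⟩ := mem_image.1 he
    exact (h.card_edge _ (Fintype.mem_piFinset.1 hω i)).le
  have h2 := le_card_sdiff ((univ.image ω).biUnion id) V
  have h3 : #V ≤ #(survivors V ω) + m * k := by
    have : #V - #((univ.image ω).biUnion id) ≤ #(survivors V ω) := h2
    omega
  have h4 : (#V : ℝ) ≤ #(survivors V ω) + m * k := by exact_mod_cast h3
  linarith

lemma NearRegular.card_star_survivors (h : NearRegular k r γ D V E) {m : ℕ}
    {ω : Fin m → Finset α} {x : α} (hx : x ∈ survivors V ω) :
    (#(star (E.filter fun e => e ⊆ survivors V ω) x) : ℝ) = avoidDegree E x ω := by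
  simp only [avoidDegree, avoids, Finset.sum_boole]
  congr 2
  ext e
  simp only [mem_filter, Finset.disjoint_left, mem_erase]
  have hx' := (mem_survivors.1 hx).2
  constructor
  · rintro ⟨⟨he, hs⟩, hxe⟩
    exact ⟨⟨he, hxe⟩, fun i y hy => (mem_survivors.1 (hs hy.2)).2 i⟩
  · rintro ⟨⟨he, hxe⟩, hs⟩
    refine ⟨⟨he, fun y hy => mem_survivors.2 ⟨h.subset e he hy, fun i => ?_⟩⟩, hxe⟩
    by_cases hyx : y = x
    · exact hyx ▸ hx' i
    · exact hs i ⟨hyx, hy⟩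

/-- If the degrees of the surviving hypergraph have small mean square deviation from `q * D`, then
the surviving hypergraph is again near-regular. -/
lemma NearRegular.survivors_nearRegular (h : NearRegular k r γ D V E) {m : ℕ}
    {ω : Fin m → Finset α} (hω : ω ∈ samples E m) {q ε γ' : ℝ} (hq : 0 < q) (hγ' : 0 < γ')
    (hγγ' : γ ≤ γ' * q) (hm : (m : ℝ) * k ≤ ε * #V)
    (hQ : ∑ x ∈ V, (avoidDegree E x ω - q * D) ^ 2 ≤ γ' ^ 3 * q ^ 2 * (1 - ε) * #V * D ^ 2) :
    NearRegular k (r / q) γ' (q * D) (survivors V ω) (E.filter fun e => e ⊆ survivors V ω) where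
  pos := mul_pos hq h.pos
  subset e he := (mem_filter.1 he).2
  card_edge e he := h.card_edge e (mem_filter.1 he).1
  degree_le x := by
    have h1 : (#(star (E.filter fun e => e ⊆ survivors V ω) x) : ℝ) ≤ #(star E x) := by
      exact_mod_cast card_le_card (filter_subset_filter _ (filter_subset _ _))
    refine (h1.trans (h.degree_le x)).trans (le_of_eq ?_)
    field_simp
  codegree_le x y hxy := by
    have h1 : (#((E.filter fun e => e ⊆ survivors V ω).filter fun e => x ∈ e ∧ y ∈ e) : ℝ) ≤
        #(E.filter fun e => x ∈ e ∧ y ∈ e) := by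
      exact_mod_cast card_le_card (filter_subset_filter _ (filter_subset _ _))
    refine (h1.trans (h.codegree_le x y hxy)).trans ?_
    rw [← mul_assoc]
    exact mul_le_mul_of_nonneg_right hγγ' h.pos.le
  card_bad := by
    have hD := h.pos
    set B := (survivors V ω).filter fun x =>
      ¬ |(#(star (E.filter fun e => e ⊆ survivors V ω) x) : ℝ) - q * D| ≤ γ' * (q * D)
    have h1 : #B * (γ' * (q * D)) ^ 2 ≤ ∑ x ∈ V, (avoidDegree E x ω - q * D) ^ 2 := by
      rw [← nsmul_eq_mul]
      refine (Finset.card_nsmul_le_sum B (fun x => (avoidDegree E x ω - q * D) ^ 2) _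
        fun x hx => ?_).trans (Finset.sum_le_sum_of_subset_of_nonneg ?_ fun _ _ _ => sq_nonneg _)
      · obtain ⟨hxs, hx⟩ := mem_filter.1 hx
        rw [h.card_star_survivors hxs, not_le] at hx
        rw [← sq_abs (avoidDegree E x ω - q * D)]
        gcongr
      · exact (filter_subset _ _).trans sdiff_subset
    have h2 : #B * (γ' * (q * D)) ^ 2 ≤ (γ' * ((1 - ε) * #V)) * (γ' * (q * D)) ^ 2 := by
      refine (h1.trans hQ).trans (le_of_eq (by ring))
    have h3 := le_of_mul_le_mul_right h2 (by positivity)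
    refine h3.trans (mul_le_mul_of_nonneg_left ?_ hγ'.le)
    linarith [h.card_survivors_ge hω]

end Survivors

lemma eventually_avoidProb (k : ℕ) (hk : 2 ≤ k) (r ε δ : ℝ) (hr : 0 ≤ r) (hε : 0 < ε)
    (hδ : 0 < δ) (j : ℕ) :
    ∀ᶠ γ : ℝ in 𝓝[>] 0, ∀ (α : Type) [DecidableEq α] (V : Finset α) (E : Finset (Finset α))
      (D : ℝ), V.Nonempty → NearRegular k r γ D V E → ∀ S ⊆ typical γ D V E, #S = j →
      |avoidProb E ⌊ε * #V / k⌋₊ S - Real.exp (-(j * ε))| ≤ δ := by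
  filter_upwards [eventually_abs_pow_sub_exp_le k (by omega) r ε δ hr hε hδ j,
    self_mem_nhdsWithin, nhdsWithin_le_nhds (gt_mem_nhds (zero_lt_one (α := ℝ)))] with γ h hγ hγ1
  intro α _ V E D hV hH S hS hj
  have hγ : 0 < γ := hγ
  obtain ⟨hb1, hb2⟩ := hH.hit_bounds S hS
  rw [hj] at hb1 hb2
  exact h #V _ D #E #(hit E S) hH.pos hV.card_pos (hH.le_card_mul hk hγ.le hγ1 hV)
    (hH.card_edges_le hr hγ.le) (hH.le_card_edges hγ1.le) hb1 hb2 (by positivity)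
    (Nat.floor_le (by positivity)) (Nat.sub_one_lt_floor _).le

/-- One step of the nibble. -/
lemma nibble (k : ℕ) (hk : 2 ≤ k) (r ε η γ' q : ℝ) (hr : 1 ≤ r) (hε : 0 < ε) (hε1 : ε < 1)
    (hη : 0 < η) (hη1 : η ≤ 1) (hγ' : 0 < γ') (hq : q = Real.exp (-((k - 1 : ℕ) * ε))) :
    ∀ᶠ γ : ℝ in 𝓝[>] 0, ∀ (α : Type) [DecidableEq α] (V : Finset α) (E : Finset (Finset α))
      (D : ℝ), V.Nonempty → NearRegular k r γ D V E → ∃ C ⊆ E, (#C : ℝ) ≤ ε * #V / k ∧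
        (#(V \ C.biUnion id) : ℝ) ≤ (Real.exp (-ε) + η) * #V ∧
        NearRegular k (r / q) γ' (q * D) (V \ C.biUnion id)
          (E.filter fun e => e ⊆ V \ C.biUnion id) := by
  have hq0 : 0 < q := hq ▸ Real.exp_pos _
  have hq1 : q ≤ 1 := by
    rw [hq, Real.exp_le_one_iff, neg_nonpos]
    positivity
  have hr0 : 0 ≤ r := by linarith
  set τ : ℝ := γ' ^ 3 * q ^ 2 * (1 - ε)
  have hτ : 0 < τ := mul_pos (by positivity) (by linarith)
  obtain ⟨δ, hδ, hδη, hδτ⟩ : ∃ δ : ℝ, 0 < δ ∧ δ ≤ η / 4 ∧ r ^ 2 * δ + 2 * r * δ ≤ η * τ / 8 := by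
    refine ⟨min (η / 4) (η * τ / (8 * (r ^ 2 + 2 * r))), by positivity, min_le_left _ _, ?_⟩
    have h1 := min_le_right (η / 4) (η * τ / (8 * (r ^ 2 + 2 * r)))
    rw [le_div_iff₀ (by positivity)] at h1
    linarith
  have hsmall : ∀ᶠ γ : ℝ in 𝓝[>] 0,
      γ ^ 2 + γ * (r + 1) ^ 2 + r * k * γ + 2 * (r + 1) * k * r * γ < η * τ / 8 := by
    have : ContinuousAt (fun γ : ℝ =>
      γ ^ 2 + γ * (r + 1) ^ 2 + r * k * γ + 2 * (r + 1) * k * r * γ) 0 := by fun_prop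
    refine (this.tendsto.mono_left nhdsWithin_le_nhds).eventually (gt_mem_nhds ?_)
    simp only [mul_zero, zero_mul, add_zero, ne_eq, OfNat.ofNat_ne_zero, not_false_eq_true,
      zero_pow]
    positivity
  filter_upwards [hsmall, self_mem_nhdsWithin,
    eventually_avoidProb k hk r ε δ hr0 hε hδ 1,
    eventually_avoidProb k hk r ε δ hr0 hε hδ (k - 1),
    eventually_avoidProb k hk r ε δ hr0 hε hδ (2 * (k - 1)),
    nhdsWithin_le_nhds (gt_mem_nhds (zero_lt_one (α := ℝ))),
    nhdsWithin_le_nhds (gt_mem_nhds (show 0 < η / 4 by positivity)),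
    nhdsWithin_le_nhds (gt_mem_nhds (show 0 < γ' * q by positivity))]
    with γ hsmall hγ hp1 hp2 hp3 hγ1 hγη hγγ'
  intro α _ V E D hV hH
  have hγ : 0 < γ := hγ
  have hD := hH.pos
  have hn : (0 : ℝ) < #V := by exact_mod_cast hV.card_pos
  have hk0 : (0 : ℝ) < k := by exact_mod_cast (show 0 < k by omega)
  have hE : E.Nonempty := by
    rw [← card_pos]
    have h1 := hH.le_card_edges hγ1.le
    have h2 : 0 < (#V : ℝ) * D * (1 - γ) ^ 2 :=
      mul_pos (by positivity) (pow_pos (by linarith) 2)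
    exact_mod_cast pos_of_mul_pos_right (h2.trans_le h1) hk0.le
  have hp1 := hp1 α V E D hV hH
  have hp2 := hp2 α V E D hV hH
  have hp3 := hp3 α V E D hV hH
  rw [← hq] at hp2
  have hq2 : Real.exp (-((2 * (k - 1) : ℕ) * ε)) = q ^ 2 := by
    rw [hq, ← Real.exp_nat_mul]
    push_cast
    ring_nf
  rw [hq2] at hp3
  rw [Nat.cast_one, one_mul] at hp1
  set m := ⌊ε * #V / k⌋₊
  have hm : (m : ℝ) ≤ ε * #V / k := Nat.floor_le (by positivity)
  have hs1 := hH.sum_survivors_le hE hδ.le (Real.exp_pos _).le hp1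
  have hs2 := hH.sum_second_moment_le hE hr0 hγ.le hδ.le hq0.le hq1 hp2 hp3
  have hne : (samples E m).Nonempty := Fintype.piFinset_nonempty.2 fun _ => hE
  obtain ⟨ω, hω, hle⟩ : ∃ ω ∈ samples E m,
      ∑ x ∈ V, avoids {x} ω + 2 / (τ * D ^ 2) * ∑ x ∈ V, (avoidDegree E x ω - q * D) ^ 2
        ≤ (Real.exp (-ε) + η) * #V := by
    refine Finset.exists_le_of_sum_le hne ?_
    rw [Finset.sum_add_distrib, ← Finset.mul_sum, sum_const, nsmul_eq_mul]
    have h1 : ∑ ω ∈ samples E m, ∑ x ∈ V, (avoidDegree E x ω - q * D) ^ 2 ≤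
        #(samples E m) * (#V * D ^ 2 * (η * τ / 4)) := by
      refine hs2.trans ?_
      gcongr
      linarith
    have h2 : 2 / (τ * D ^ 2) * ∑ ω ∈ samples E m, ∑ x ∈ V, (avoidDegree E x ω - q * D) ^ 2 ≤
        #(samples E m) * (#V * (η / 2)) := by
      refine (mul_le_mul_of_nonneg_left h1 (by positivity)).trans (le_of_eq ?_)
      field_simp
      ring
    have h3 : (#(samples E m) : ℝ) * (#V * (Real.exp (-ε) + δ + γ)) ≤
        #(samples E m) * (#V * (Real.exp (-ε) + η / 2)) := by
      refine mul_le_mul_of_nonneg_left (mul_le_mul_of_nonneg_left ?_ hn.le) (by positivity)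
      linarith
    linarith
  have hQ0 : 0 ≤ ∑ x ∈ V, (avoidDegree E x ω - q * D) ^ 2 :=
    Finset.sum_nonneg fun _ _ => sq_nonneg _
  rw [← card_survivors] at hle
  refine ⟨univ.image ω, ?_, ?_, ?_, ?_⟩
  · intro e he
    obtain ⟨i, -, rfl⟩ := mem_image.1 he
    exact Fintype.mem_piFinset.1 hω i
  · refine le_trans ?_ hm
    exact_mod_cast card_image_le.trans (by simp)
  · have : 0 ≤ 2 / (τ * D ^ 2) * ∑ x ∈ V, (avoidDegree E x ω - q * D) ^ 2 := by positivity
    exact (le_add_of_nonneg_right this).trans hle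
  · refine hH.survivors_nearRegular hω hq0 hγ' hγγ'.le (ε := ε) ?_ ?_
    · rwa [le_div_iff₀ hk0] at hm
    · have h1 : (Real.exp (-ε) + η) * #V ≤ 2 * #V := by
        have : Real.exp (-ε) ≤ 1 := Real.exp_le_one_iff.2 (by linarith)
        gcongr
        linarith
      have h2 : 2 / (τ * D ^ 2) * ∑ x ∈ V, (avoidDegree E x ω - q * D) ^ 2 ≤ 2 * #V := by
        have : (0 : ℝ) ≤ #(survivors V ω) := by positivity
        linarith
      rw [div_mul_eq_mul_div, div_le_iff₀ (by positivity)] at h2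
      linarith

/-- `c` bounds, relative to the number of vertices, the number of edges and singletons needed to
cover every sufficiently near-regular `k`-uniform hypergraph. -/
def IsCoverConst (k : ℕ) (c : ℝ) : Prop :=
  0 ≤ c ∧ ∀ r : ℝ, 1 ≤ r → ∃ γ : ℝ, 0 < γ ∧ ∀ (α : Type) [DecidableEq α] (V : Finset α)
    (E : Finset (Finset α)) (D : ℝ), NearRegular k r γ D V E →
      ∃ C ⊆ E, (#C : ℝ) + #(V \ C.biUnion id) ≤ c * #V

lemma isCoverConst_one (k : ℕ) : IsCoverConst k 1 :=
  ⟨zero_le_one, fun _ _ => ⟨1, one_pos, fun _ _ _ _ _ _ => ⟨∅, by simp, by simp⟩⟩⟩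

lemma IsCoverConst.step {k : ℕ} (hk : 2 ≤ k) {c : ℝ} (hc : IsCoverConst k c) {ε η : ℝ}
    (hε : 0 < ε) (hε1 : ε < 1) (hη : 0 < η) (hη1 : η ≤ 1) :
    IsCoverConst k (ε / k + c * (Real.exp (-ε) + η)) := by
  obtain ⟨hc0, hc⟩ := hc
  refine ⟨by positivity, fun r hr => ?_⟩
  set q := Real.exp (-((k - 1 : ℕ) * ε)) with hq
  have hq0 : 0 < q := Real.exp_pos _
  have hq1 : q ≤ 1 := by
    rw [hq, Real.exp_le_one_iff, neg_nonpos]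
    positivity
  obtain ⟨γ', hγ', hcov⟩ := hc (r / q) (by rw [le_div_iff₀ hq0]; linarith)
  obtain ⟨γ, hγ, hpos⟩ :=
    ((nibble k hk r ε η γ' q hr hε hε1 hη hη1 hγ' hq).and self_mem_nhdsWithin).exists
  refine ⟨γ, hpos, fun α _ V E D hH => ?_⟩
  rcases V.eq_empty_or_nonempty with rfl | hV
  · exact ⟨∅, by simp, by simp⟩
  obtain ⟨C₁, hC₁, hcard₁, hrem, hH'⟩ := hγ α V E D hV hH
  obtain ⟨C₂, hC₂, hcard₂⟩ := hcov α _ _ _ hH'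
  refine ⟨C₁ ∪ C₂, union_subset hC₁ (hC₂.trans (filter_subset _ _)), ?_⟩
  have hdiff : V \ (C₁ ∪ C₂).biUnion id = (V \ C₁.biUnion id) \ C₂.biUnion id := by
    rw [union_biUnion, sdiff_sdiff, sup_eq_union]
  rw [hdiff]
  have h1 : (#(C₁ ∪ C₂) : ℝ) ≤ #C₁ + #C₂ := by exact_mod_cast card_union_le _ _
  have h2 := mul_le_mul_of_nonneg_left hrem hc0
  have h3 : ε * #V / k = ε / k * #V := by ring
  linarith

lemma exists_isCoverConst_lt {k : ℕ} (hk : 2 ≤ k) {b : ℝ} (hb : 1 / k < b) :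
    ∃ c < b, IsCoverConst k c := by
  have hk0 : (0 : ℝ) < k := by exact_mod_cast (show 0 < k by omega)
  have hne : {c | IsCoverConst k c}.Nonempty := ⟨1, isCoverConst_one k⟩
  have hbdd : BddBelow {c | IsCoverConst k c} := ⟨0, fun c hc => hc.1⟩
  set s := sInf {c | IsCoverConst k c} with hs
  have hs0 : 0 ≤ s := le_csInf hne fun c hc => hc.1
  have hfix : ∀ ε : ℝ, 0 < ε → ε < 1 → s ≤ ε / k + s * Real.exp (-ε) := by
    intro ε hε hε1
    refine le_of_forall_pos_le_add fun η hη => ?_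
    obtain ⟨c, hc, hcs⟩ := exists_lt_of_csInf_lt hne (show s < s + η / 3 by linarith)
    obtain ⟨θ, hθ, hθ1, hθc⟩ : ∃ θ : ℝ, 0 < θ ∧ θ ≤ 1 ∧ c * θ ≤ η / 3 := by
      refine ⟨min 1 (η / (3 * (c + 1))), ?_, min_le_left _ _, ?_⟩
      · have := hc.1
        positivity
      · have h0 := hc.1
        have h1 := min_le_right 1 (η / (3 * (c + 1)))
        have h2 : 0 < min 1 (η / (3 * (c + 1))) := by positivity
        rw [le_div_iff₀ (by positivity)] at h1
        linarith
    have h1 := csInf_le hbdd (IsCoverConst.step hk hc hε hε1 hθ hθ1)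
    have h2 : c * Real.exp (-ε) ≤ (s + η / 3) * Real.exp (-ε) := by gcongr
    have h3 : η / 3 * Real.exp (-ε) ≤ η / 3 * 1 := by
      gcongr
      exact Real.exp_le_one_iff.2 (by linarith)
    linarith
  have hle : ∀ ε : ℝ, 0 < ε → ε < 1 → s ≤ (1 + ε) / k := by
    intro ε hε hε1
    have h1 := hfix ε hε hε1
    have h2 : Real.exp (-ε) ≤ 1 / (1 + ε) := by
      rw [Real.exp_neg, ← one_div]
      exact one_div_le_one_div_of_le (by positivity) (by linarith [Real.add_one_le_exp ε])
    have h3 := h1.trans (add_le_add_right (mul_le_mul_of_nonneg_left h2 hs0) _)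
    rw [le_div_iff₀ hk0]
    field_simp at h3
    nlinarith
  have hsk : s ≤ 1 / k := by
    have ht : Tendsto (fun ε : ℝ => (1 + ε) / k) (𝓝[>] 0) (𝓝 ((1 + 0) / k)) :=
      ((continuous_const.add continuous_id).div_const _).continuousAt.tendsto.mono_left
        nhdsWithin_le_nhds
    rw [add_zero] at ht
    refine ge_of_tendsto ht ?_
    filter_upwards [self_mem_nhdsWithin,
      nhdsWithin_le_nhds (gt_mem_nhds (zero_lt_one (α := ℝ)))] with ε h1 h2
    exact hle ε h1 h2
  obtain ⟨c, hc, hcb⟩ := exists_lt_of_csInf_lt hne (hsk.trans_lt hb)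
  exact ⟨c, hcb, hc⟩

/-- Uncovered vertices of positive degree can be covered by one further edge each. -/
lemma exists_cover {α : Type*} [DecidableEq α] (V : Finset α) (E C : Finset (Finset α))
    (hC : C ⊆ E) (hpos : ∀ x ∈ V, ∃ e ∈ E, x ∈ e) :
    ∃ C' ⊆ E, V ⊆ C'.biUnion id ∧ #C' ≤ #C + #(V \ C.biUnion id) := by
  choose! f hfE hf using hpos
  refine ⟨C ∪ (V \ C.biUnion id).image f, union_subset hC ?_, fun x hx => ?_,
    (card_union_le _ _).trans (Nat.add_le_add_left card_image_le _)⟩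
  · intro e he
    obtain ⟨x, hx, rfl⟩ := mem_image.1 he
    exact hfE x (mem_sdiff.1 hx).1
  · rw [union_biUnion]
    by_cases hxC : x ∈ C.biUnion id
    · exact mem_union_left _ hxC
    · exact mem_union_right _ (mem_biUnion.2
        ⟨f x, mem_image_of_mem f (mem_sdiff.2 ⟨hx, hxC⟩), hf x hx⟩)

end Nibble

/-- Pippenger's theorem (Theorem 6.4 of the paper): for `k ≥ 2`, `r ≥ 1`, `a > 0` there are
`γ > 0` and `d₀` such that for every `n` and `D ≥ d₀`, every `k`-uniform hypergraph on `n`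
vertices in which all vertices have positive degree, almost all degrees are `(1 ± γ)D`,
all degrees are `< rD`, and all codegrees are `< γD`, has an edge cover with at most
`(1+a)(n/k)` edges. -/
theorem stmt_18 (k : ℕ) (hk : 2 ≤ k) (r a : ℝ) (hr : 1 ≤ r) (ha : 0 < a) :
    ∃ γ : ℝ, 0 < γ ∧ ∃ d₀ : ℝ, ∀ n : ℕ, ∀ D : ℝ, d₀ ≤ D →
    ∀ E : Finset (Finset (Fin n)), (∀ e ∈ E, e.card = k) →
      (∀ x : Fin n, 0 < (E.filter fun e => x ∈ e).card) →
      (((Finset.univ.filter fun x : Fin n =>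
          ¬ |((E.filter fun e => x ∈ e).card : ℝ) - D| ≤ γ * D).card : ℝ) ≤ γ * n) →
      (∀ x : Fin n, ((E.filter fun e => x ∈ e).card : ℝ) < r * D) →
      (∀ x y : Fin n, x ≠ y →
        ((E.filter fun e => x ∈ e ∧ y ∈ e).card : ℝ) < γ * D) →
      ∃ C ⊆ E, C.biUnion id = Finset.univ ∧ (C.card : ℝ) ≤ (1 + a) * ((n : ℝ) / k) := by
  have hk0 : (0 : ℝ) < k := by exact_mod_cast (show 0 < k by omega)
  obtain ⟨c, hcb, -, hc⟩ := Nibble.exists_isCoverConst_lt hk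
    (show 1 / (k : ℝ) < (1 + a) / k by gcongr; linarith)
  obtain ⟨γ, hγ, hcov⟩ := hc r hr
  refine ⟨γ, hγ, 1, fun n D hD E hcard hpos hbad hdeg hcod => ?_⟩
  have hH : Nibble.NearRegular k r γ D Finset.univ E :=
    { pos := by linarith
      subset := fun e _ => Finset.subset_univ e
      card_edge := hcard
      card_bad := by simpa using hbad
      degree_le := fun x => (hdeg x).le
      codegree_le := fun x y hxy => (hcod x y hxy).le }
  obtain ⟨C, hC, hCcard⟩ := hcov (Fin n) _ E D hH
  obtain ⟨C', hC', hcover, hle⟩ := Nibble.exists_cover Finset.univ E C hC fun x _ => by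
    obtain ⟨e, he⟩ := Finset.card_pos.1 (hpos x)
    exact ⟨e, Finset.mem_filter.1 he⟩
  refine ⟨C', hC', Finset.univ_subset_iff.1 hcover, ?_⟩
  have h1 : (C'.card : ℝ) ≤ C.card + (Finset.univ \ C.biUnion id).card := by exact_mod_cast hle
  rw [Finset.card_univ, Fintype.card_fin] at hCcard
  have h2 : c * n ≤ (1 + a) / k * n := by gcongr
  have h3 : (1 + a) / k * (n : ℝ) = (1 + a) * (n / k) := by ring
  linarith
end
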